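/- Let n ≥ 1, 0 ≤ r ≤ n, and let Λ ∈ M_n(k*) be multiplicatively antisymmetric. Let (D, ι) be a division ring of fractions of S_{n,r}^Λ(k). Then r is the smallest natural number m for which there exist s, t ∈ ℕ, a tuple q̄ = (q_1,…,q_s) with each q_i ∈ k∖{0,1}, a division ring of fractions (D', ι') of A_{m,s,t}^{q̄}(k), and an injective k-algebra homomorphism from D into D'. (Equivalently, the w-upper degree of Frac(S_{n,r}^Λ(k)) equals 2r.) -/

import Mathlib

universe u

/-- A matrix is multiplicatively antisymmetric if `Λ i i = 1` and `Λ i j * Λ j i = 1`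
for all `i, j`. -/
def Matrix.MulAntisymmetric {k : Type u} [Field k] {n : ℕ}
    (Λ : Matrix (Fin n) (Fin n) k) : Prop :=
  (∀ i, Λ i i = 1) ∧ ∀ i j, Λ i j * Λ j i = 1

inductive MixedCrossedRel (k : Type u) [Field k] {n : ℕ} (Λ : Matrix (Fin n) (Fin n) k)
    (r : ℕ) (hr : r ≤ n) :
    FreeAlgebra k (Fin n ⊕ Fin r) → FreeAlgebra k (Fin n ⊕ Fin r) → Prop
  | yy (i j : Fin n) :
      MixedCrossedRel k Λ r hr
        (FreeAlgebra.ι k (Sum.inl i) * FreeAlgebra.ι k (Sum.inl j))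
        (algebraMap k _ (Λ i j) * (FreeAlgebra.ι k (Sum.inl j) * FreeAlgebra.ι k (Sum.inl i)))
  | xy_same (i : Fin r) :
      MixedCrossedRel k Λ r hr
        (FreeAlgebra.ι k (Sum.inr i) * FreeAlgebra.ι k (Sum.inl (Fin.castLE hr i)))
        (FreeAlgebra.ι k (Sum.inl (Fin.castLE hr i)) * FreeAlgebra.ι k (Sum.inr i) + 1)
  | xy_ne (i : Fin r) (j : Fin n) (hij : Fin.castLE hr i ≠ j) :
      MixedCrossedRel k Λ r hr
        (FreeAlgebra.ι k (Sum.inr i) * FreeAlgebra.ι k (Sum.inl j))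
        (algebraMap k _ (Λ (Fin.castLE hr i) j)⁻¹ *
          (FreeAlgebra.ι k (Sum.inl j) * FreeAlgebra.ι k (Sum.inr i)))
  | xx (i j : Fin r) :
      MixedCrossedRel k Λ r hr
        (FreeAlgebra.ι k (Sum.inr i) * FreeAlgebra.ι k (Sum.inr j))
        (algebraMap k _ (Λ (Fin.castLE hr i) (Fin.castLE hr j)) *
          (FreeAlgebra.ι k (Sum.inr j) * FreeAlgebra.ι k (Sum.inr i)))

/-- The mixed crossed polynomial algebra `S_{n,r}^Λ(k)`. -/
def MixedCrossedAlgebra (k : Type u) [Field k] {n : ℕ} (Λ : Matrix (Fin n) (Fin n) k)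
    (r : ℕ) (hr : r ≤ n) :=
  RingQuot (MixedCrossedRel k Λ r hr)

noncomputable instance (k : Type u) [Field k] {n : ℕ} (Λ : Matrix (Fin n) (Fin n) k)
    (r : ℕ) (hr : r ≤ n) : Ring (MixedCrossedAlgebra k Λ r hr) := by
  unfold MixedCrossedAlgebra; infer_instance

noncomputable instance (k : Type u) [Field k] {n : ℕ} (Λ : Matrix (Fin n) (Fin n) k)
    (r : ℕ) (hr : r ≤ n) : Algebra k (MixedCrossedAlgebra k Λ r hr) := by
  unfold MixedCrossedAlgebra; infer_instance

/-- The generator `y_j` of `S_{n,r}^Λ(k)`. -/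
noncomputable def MixedCrossedAlgebra.y (k : Type u) [Field k] {n : ℕ}
    (Λ : Matrix (Fin n) (Fin n) k) (r : ℕ) (hr : r ≤ n) (j : Fin n) :
    MixedCrossedAlgebra k Λ r hr :=
  RingQuot.mkAlgHom k (MixedCrossedRel k Λ r hr) (FreeAlgebra.ι k (Sum.inl j))

/-- The generator `x_i` of `S_{n,r}^Λ(k)`. -/
noncomputable def MixedCrossedAlgebra.x (k : Type u) [Field k] {n : ℕ}
    (Λ : Matrix (Fin n) (Fin n) k) (r : ℕ) (hr : r ≤ n) (i : Fin r) :
    MixedCrossedAlgebra k Λ r hr :=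
  RingQuot.mkAlgHom k (MixedCrossedRel k Λ r hr) (FreeAlgebra.ι k (Sum.inr i))


inductive MWGen (m n t : ℕ) : Type
  | x : Fin m → MWGen m n t
  | y : Fin m → MWGen m n t
  | u : Fin n → MWGen m n t
  | v : Fin n → MWGen m n t
  | z : Fin t → MWGen m n t

/-- The pairs of generators of `A_{m,n,t}^{q̄}(k)` satisfying a non-trivial relation. -/
def MWGen.IsSpecialPair {m n t : ℕ} : MWGen m n t → MWGen m n t → Prop
  | .x i, .y j => i = j
  | .y i, .x j => i = j
  | .u i, .v j => i = j
  | .v i, .u j => i = j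
  | _, _ => False

/-- Defining relations of the algebra `A_{m,n,t}^{q̄}(k)`. -/
inductive MWRel (k : Type u) [Field k] (m n t : ℕ) (q : Fin n → k) :
    FreeAlgebra k (MWGen m n t) → FreeAlgebra k (MWGen m n t) → Prop
  | weyl (i : Fin m) :
      MWRel k m n t q (FreeAlgebra.ι k (MWGen.x i) * FreeAlgebra.ι k (MWGen.y i))
        (FreeAlgebra.ι k (MWGen.y i) * FreeAlgebra.ι k (MWGen.x i) + 1)
  | quantum (i : Fin n) :
      MWRel k m n t q (FreeAlgebra.ι k (MWGen.u i) * FreeAlgebra.ι k (MWGen.v i))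
        (algebraMap k _ (q i) * (FreeAlgebra.ι k (MWGen.v i) * FreeAlgebra.ι k (MWGen.u i)))
  | comm (a b : MWGen m n t) (hab : a ≠ b) (h : ¬ a.IsSpecialPair b) :
      MWRel k m n t q (FreeAlgebra.ι k a * FreeAlgebra.ι k b)
        (FreeAlgebra.ι k b * FreeAlgebra.ι k a)

/-- The algebra `A_{m,n,t}^{q̄}(k)` (tensor product of a Weyl algebra, quantum planes and
a commutative polynomial algebra), whose fraction division ring is the mixed Weyl
skew field `D_{m,n,t}^{q̄}(k)`. -/
def MixedWeylAlgebra (k : Type u) [Field k] (m n t : ℕ) (q : Fin n → k) :=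
  RingQuot (MWRel k m n t q)

noncomputable instance (k : Type u) [Field k] (m n t : ℕ) (q : Fin n → k) :
    Ring (MixedWeylAlgebra k m n t q) := by unfold MixedWeylAlgebra; infer_instance

noncomputable instance (k : Type u) [Field k] (m n t : ℕ) (q : Fin n → k) :
    Algebra k (MixedWeylAlgebra k m n t q) := by unfold MixedWeylAlgebra; infer_instance

/-- The Weyl algebra `A_m(k) = A_{m,0,0}(k)`. -/
def WeylAlgebra (k : Type u) [Field k] (m : ℕ) := MixedWeylAlgebra k m 0 0 Fin.elim0

noncomputable instance (k : Type u) [Field k] (m : ℕ) : Ring (WeylAlgebra k m) := by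
  unfold WeylAlgebra; infer_instance

noncomputable instance (k : Type u) [Field k] (m : ℕ) : Algebra k (WeylAlgebra k m) := by
  unfold WeylAlgebra; infer_instance

structure FractionDivisionRing (k : Type u) [Field k] (A : Type u) [Ring A] [Algebra k A] where
  carrier : Type u
  [divisionRing : DivisionRing carrier]
  [algebra : Algebra k carrier]
  emb : A →ₐ[k] carrier
  emb_injective : Function.Injective emb
  frac : ∀ d : carrier, ∃ a b : A, b ≠ 0 ∧ d = emb a * (emb b)⁻¹

attribute [instance] FractionDivisionRing.divisionRing FractionDivisionRing.algebra

/-- The twisted Laurent polynomial ring over `R[w_j : j ∈ J]` with exponents in `Γ`: its elements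
are finite sums `∑ p_a T_a`, with `T_a p = p(w - δ(a)) T_a` and `T_a T_b = c(a, b) T_{a + b}`. -/
def CrossedLaurent {R Γ J : Type*} [CommRing R] [AddCommGroup Γ]
    (_δ : J → Γ →+ ℤ) (_c : Γ →+ Γ →+ Additive Rˣ) : Type _ :=
  Γ →₀ MvPolynomial J R

namespace CrossedLaurent

open MvPolynomial

section Shift

variable {R Γ J : Type*} [CommRing R] [AddCommGroup Γ] (δ : J → Γ →+ ℤ)

/-- The translation `w_j ↦ w_j - δ_j(a)`. -/
noncomputable def shift (R : Type*) [CommRing R] (a : Γ) :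
    MvPolynomial J R →ₐ[R] MvPolynomial J R :=
  aeval fun j => X j - C ((δ j a : ℤ) : R)

@[simp] lemma shift_X (a : Γ) (j : J) : shift δ R a (X j) = X j - C ((δ j a : ℤ) : R) := by
  simp [shift]

@[simp] lemma shift_C (a : Γ) (r : R) : shift δ R a (C r) = C r := by
  simp [shift]

@[simp] lemma shift_zero (p : MvPolynomial J R) : shift δ R 0 p = p := by
  have : shift δ R 0 = AlgHom.id R _ := by
    ext j : 1
    simp
  rw [this, AlgHom.id_apply]

lemma shift_shift (a b : Γ) (p : MvPolynomial J R) :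
    shift δ R a (shift δ R b p) = shift δ R (a + b) p := by
  have : (shift δ R a).comp (shift δ R b) = shift δ R (a + b) := by
    ext j : 1
    simp [sub_sub]
  rw [← this, AlgHom.comp_apply]

lemma shift_injective (a : Γ) : Function.Injective (shift δ R a) := fun p q h => by
  have := congrArg (shift δ R (-a)) h
  simpa [shift_shift] using this

lemma map_shift {S : Type*} [CommRing S] (φ : R →+* S) (a : Γ) (p : MvPolynomial J R) :
    map φ (shift δ R a p) = shift δ S a (map φ p) := by
  induction p using MvPolynomial.induction_on with
  | C r => simp
  | add p q hp hq => simp [hp, hq]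
  | mul_X p j hp => simp [hp]

end Shift

variable {R Γ J : Type*} [CommRing R] [AddCommGroup Γ]
  {δ : J → Γ →+ ℤ} {c : Γ →+ Γ →+ Additive Rˣ}

noncomputable instance : AddCommGroup (CrossedLaurent δ c) :=
  inferInstanceAs (AddCommGroup (Γ →₀ MvPolynomial J R))

noncomputable instance : Module R (CrossedLaurent δ c) :=
  inferInstanceAs (Module R (Γ →₀ MvPolynomial J R))

/-- The homogeneous element `p T_a`. -/
noncomputable def single (δ : J → Γ →+ ℤ) (c : Γ →+ Γ →+ Additive Rˣ) (a : Γ)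
    (p : MvPolynomial J R) : CrossedLaurent δ c :=
  Finsupp.single a p

/-- The coefficient of `T_a`. -/
noncomputable def coeff (b : CrossedLaurent δ c) (a : Γ) : MvPolynomial J R :=
  DFunLike.coe (F := Γ →₀ MvPolynomial J R) b a

/-- The degrees occurring in an element. -/
noncomputable def support (b : CrossedLaurent δ c) : Finset Γ :=
  Finsupp.support (b : Γ →₀ MvPolynomial J R)

@[ext] lemma ext {b b' : CrossedLaurent δ c} (h : ∀ a, b.coeff a = b'.coeff a) : b = b' :=
  Finsupp.ext h

lemma mem_support {b : CrossedLaurent δ c} {a : Γ} : a ∈ b.support ↔ b.coeff a ≠ 0 :=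
  Finsupp.mem_support_iff

@[simp] lemma coeff_zero (a : Γ) : (0 : CrossedLaurent δ c).coeff a = 0 := rfl

@[simp] lemma coeff_add (b b' : CrossedLaurent δ c) (a : Γ) :
    (b + b').coeff a = b.coeff a + b'.coeff a := rfl

@[simp] lemma coeff_smul (r : R) (b : CrossedLaurent δ c) (a : Γ) :
    (r • b).coeff a = r • b.coeff a := rfl

open scoped Classical in
lemma coeff_single (a a' : Γ) (p : MvPolynomial J R) :
    (single δ c a p).coeff a' = if a = a' then p else 0 :=
  Finsupp.single_apply

lemma coeff_sum {ι : Type*} (s : Finset ι) (f : ι → CrossedLaurent δ c) (a : Γ) :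
    (∑ i ∈ s, f i).coeff a = ∑ i ∈ s, (f i).coeff a :=
  Finsupp.finsetSum_apply s f a

@[simp] lemma single_zero (a : Γ) : single δ c a 0 = 0 := Finsupp.single_zero a

lemma single_add (a : Γ) (p q : MvPolynomial J R) :
    single δ c a (p + q) = single δ c a p + single δ c a q := Finsupp.single_add a p q

lemma smul_single (r : R) (a : Γ) (p : MvPolynomial J R) :
    r • single δ c a p = single δ c a (C r * p) := by
  rw [← MvPolynomial.smul_eq_C_mul]
  exact Finsupp.smul_single r a p

lemma single_injective (a : Γ) : Function.Injective (single δ c a) := Finsupp.single_injective a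

lemma sum_single (b : CrossedLaurent δ c) : ∑ a ∈ b.support, single δ c a (b.coeff a) = b :=
  Finsupp.sum_single (b : Γ →₀ MvPolynomial J R)

lemma induction_on {motive : CrossedLaurent δ c → Prop} (b : CrossedLaurent δ c)
    (zero : motive 0) (add : ∀ b b', motive b → motive b' → motive (b + b'))
    (single : ∀ a p, motive (single δ c a p)) : motive b :=
  Finsupp.induction_linear (motive := motive) b zero add single

/-- An additive map out of the twisted Laurent polynomial ring, from its homogeneous parts. -/
noncomputable def lift {N : Type*} [AddCommMonoid N] (f : Γ → MvPolynomial J R →+ N) :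
    CrossedLaurent δ c →+ N :=
  Finsupp.liftAddHom f

@[simp] lemma lift_single {N : Type*} [AddCommMonoid N] (f : Γ → MvPolynomial J R →+ N)
    (a : Γ) (p : MvPolynomial J R) : lift f (single δ c a p) = f a p :=
  Finsupp.liftAddHom_apply_single f a p

/-- The product of homogeneous elements. -/
noncomputable def singleMul (δ : J → Γ →+ ℤ) (c : Γ →+ Γ →+ Additive Rˣ) (a b : Γ) :
    MvPolynomial J R →+ MvPolynomial J R →+ CrossedLaurent δ c :=
  AddMonoidHom.mk' (fun p => AddMonoidHom.mk'
    (fun q => single δ c (a + b) (C ((c a b).toMul : R) * (p * shift δ R a q)))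
    (fun q q' => by simp [mul_add, single_add]))
    (fun p p' => AddMonoidHom.ext fun q => by simp [mul_add, add_mul, single_add])

/-- The multiplication of the twisted Laurent polynomial ring. -/
noncomputable def mulHom : CrossedLaurent δ c →+ CrossedLaurent δ c →+ CrossedLaurent δ c :=
  lift fun a => (lift fun b => (singleMul δ c a b).flip).flip

noncomputable instance : Mul (CrossedLaurent δ c) := ⟨fun b b' => mulHom b b'⟩

noncomputable instance : One (CrossedLaurent δ c) := ⟨single δ c 0 1⟩

lemma one_def : (1 : CrossedLaurent δ c) = single δ c 0 1 := rfl

lemma single_mul_single (a b : Γ) (p q : MvPolynomial J R) :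
    single δ c a p * single δ c b q =
      single δ c (a + b) (C ((c a b).toMul : R) * (p * shift δ R a q)) := by
  change mulHom (single δ c a p) (single δ c b q) = _
  simp [mulHom, singleMul]

private lemma left_distrib' (x y z : CrossedLaurent δ c) : x * (y + z) = x * y + x * z :=
  map_add (mulHom x) y z

private lemma right_distrib' (x y z : CrossedLaurent δ c) : (x + y) * z = x * z + y * z := by
  change mulHom (x + y) z = mulHom x z + mulHom y z
  simp

private lemma zero_mul' (x : CrossedLaurent δ c) : 0 * x = 0 := by
  change mulHom 0 x = 0
  simp

private lemma mul_zero' (x : CrossedLaurent δ c) : x * 0 = 0 := map_zero (mulHom x)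

noncomputable instance : Ring (CrossedLaurent δ c) where
  left_distrib := left_distrib'
  right_distrib := right_distrib'
  zero_mul := zero_mul'
  mul_zero := mul_zero'
  one_mul x := by
    induction x using CrossedLaurent.induction_on with
    | zero => exact mul_zero' 1
    | add x y hx hy => rw [left_distrib', hx, hy]
    | single a p => rw [one_def, single_mul_single]; simp
  mul_one x := by
    induction x using CrossedLaurent.induction_on with
    | zero => exact zero_mul' 1
    | add x y hx hy => rw [right_distrib', hx, hy]
    | single a p => rw [one_def, single_mul_single]; simp
  mul_assoc x y z := by
    induction x using CrossedLaurent.induction_on with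
    | zero => simp only [zero_mul']
    | add x x' hx hx' => simp only [right_distrib', hx, hx']
    | single a p =>
    induction y using CrossedLaurent.induction_on with
    | zero => simp only [zero_mul', mul_zero']
    | add y y' hy hy' => simp only [right_distrib', left_distrib', hy, hy']
    | single b q =>
    induction z using CrossedLaurent.induction_on with
    | zero => simp only [mul_zero']
    | add z z' hz hz' => simp only [left_distrib', hz, hz']
    | single d r =>
      simp only [single_mul_single, map_add, map_mul, shift_C, shift_shift, AddMonoidHom.add_apply,
        toMul_add, Units.val_mul, add_assoc]
      congr 1
      ring
  zsmul := fun n x => n • x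
  zsmul_zero' := SubNegMonoid.zsmul_zero'
  zsmul_succ' := SubNegMonoid.zsmul_succ'
  zsmul_neg' := SubNegMonoid.zsmul_neg'
  neg_add_cancel := neg_add_cancel
  sub_eq_add_neg := sub_eq_add_neg

noncomputable instance : Algebra R (CrossedLaurent δ c) :=
  Algebra.ofModule
    (fun r x y => by
      induction x using CrossedLaurent.induction_on with
      | zero => simp
      | add x x' hx hx' => simp only [add_mul, smul_add, hx, hx']
      | single a p =>
      induction y using CrossedLaurent.induction_on with
      | zero => simp
      | add y y' hy hy' => simp only [mul_add, smul_add, hy, hy']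
      | single b q =>
        simp only [smul_single, single_mul_single]
        congr 1
        ring)
    (fun r x y => by
      induction x using CrossedLaurent.induction_on with
      | zero => simp
      | add x x' hx hx' => simp only [add_mul, smul_add, hx, hx']
      | single a p =>
      induction y using CrossedLaurent.induction_on with
      | zero => simp
      | add y y' hy hy' => simp only [mul_add, smul_add, hy, hy']
      | single b q =>
        simp only [smul_single, single_mul_single, map_mul, shift_C]
        congr 1
        ring)

/-- If `a₀ + b₀` is uniquely a sum of degrees of `x` and `y`, the coefficient of the product in that
degree has a single contribution. -/
lemma coeff_mul_of_uniqueAdd {x y : CrossedLaurent δ c} {a₀ b₀ : Γ}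
    (h : UniqueAdd x.support y.support a₀ b₀) :
    (x * y).coeff (a₀ + b₀) =
      C ((c a₀ b₀).toMul : R) * (x.coeff a₀ * shift δ R a₀ (y.coeff b₀)) := by
  classical
  have key : (x * y).coeff (a₀ + b₀) = ∑ a ∈ x.support, ∑ b ∈ y.support,
      (single δ c a (x.coeff a) * single δ c b (y.coeff b)).coeff (a₀ + b₀) := by
    conv_lhs => rw [← sum_single x, ← sum_single y]
    simp only [Finset.sum_mul_sum, coeff_sum]
  rw [key, Finset.sum_eq_single a₀, Finset.sum_eq_single b₀]
  · rw [single_mul_single, coeff_single, if_pos rfl]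
  · intro b hb hne
    rw [single_mul_single, coeff_single]
    split_ifs with heq
    · exact absurd (add_left_cancel heq) hne
    · rfl
  · intro hb
    rw [mem_support, not_not] at hb
    rw [hb]
    simp
  · intro a ha hne
    refine Finset.sum_eq_zero fun b hb => ?_
    rw [single_mul_single, coeff_single]
    split_ifs with heq
    · exact absurd (h ha hb heq).1 hne
    · rfl
  · intro ha
    rw [mem_support, not_not] at ha
    refine Finset.sum_eq_zero fun b hb => ?_
    rw [ha]
    simp

instance [IsDomain R] [UniqueSums Γ] : NoZeroDivisors (CrossedLaurent δ c) where
  eq_zero_or_eq_zero_of_mul_eq_zero {x y} hxy := by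
    by_contra! hne
    have hsupp : ∀ z : CrossedLaurent δ c, z ≠ 0 → z.support.Nonempty := fun z hz => by
      rw [Finset.nonempty_iff_ne_empty]
      intro he
      exact hz (by rw [← sum_single z, he, Finset.sum_empty])
    obtain ⟨a, ha, b, hb, hu⟩ :=
      UniqueSums.uniqueAdd_of_nonempty (hsupp x hne.1) (hsupp y hne.2)
    have h := coeff_mul_of_uniqueAdd hu
    rw [hxy, coeff_zero, eq_comm] at h
    rw [mem_support] at ha hb
    simp only [mul_eq_zero, C_eq_zero, Units.ne_zero, false_or, ha] at h
    exact hb (shift_injective δ a (by rw [h, map_zero]))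

instance [Nontrivial R] : Nontrivial (CrossedLaurent δ c) :=
  ⟨⟨1, 0, fun h => by
    have := congrArg (fun x => x.coeff 0) h
    simp [one_def, coeff_single] at this⟩⟩

end CrossedLaurent

/-- A family of elements `y_i`, `x_j` generating an algebra, such that `x_j` and `y_{e(j)}` satisfy
the Weyl relation and all the other pairs commute up to nonzero scalars. -/
structure QuasiWeylGenerators (k : Type*) [Field k] {A ι J : Type*} [Ring A] [Algebra k A]
    (e : J → ι) (y : ι → A) (x : J → A) : Prop where
  yy : ∀ i i', ∃ u : k, u ≠ 0 ∧ y i * y i' = u • (y i' * y i)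
  xx : ∀ j j', ∃ u : k, u ≠ 0 ∧ x j * x j' = u • (x j' * x j)
  xy_ne : ∀ j i, e j ≠ i → ∃ u : k, u ≠ 0 ∧ x j * y i = u • (y i * x j)
  xy_same : ∀ j, x j * y (e j) = y (e j) * x j + 1
  adjoin_eq_top : Algebra.adjoin k (Set.range y ∪ Set.range x) = ⊤

section ScalarCommute

variable (k : Type*) [Field k] {A : Type*} [Ring A] [Algebra k A]

/-- Two elements commute up to a nonzero scalar. -/
def ScalarCommute (a b : A) : Prop := ∃ u : k, u ≠ 0 ∧ a * b = u • (b * a)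

variable {k}

lemma ScalarCommute.one_right (a : A) : ScalarCommute k a 1 := ⟨1, one_ne_zero, by simp⟩

lemma ScalarCommute.mul_right {a b c : A} (hb : ScalarCommute k a b) (hc : ScalarCommute k a c) :
    ScalarCommute k a (b * c) := by
  obtain ⟨u, hu, hb⟩ := hb
  obtain ⟨v, hv, hc⟩ := hc
  refine ⟨u * v, mul_ne_zero hu hv, ?_⟩
  rw [← mul_assoc, hb, smul_mul_assoc, mul_assoc, hc, mul_smul_comm, smul_smul, mul_assoc]

lemma ScalarCommute.pow_right {a b : A} (h : ScalarCommute k a b) (n : ℕ) :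
    ScalarCommute k a (b ^ n) := by
  induction n with
  | zero => simpa using ScalarCommute.one_right a
  | succ n ih => rw [pow_succ]; exact ih.mul_right h

end ScalarCommute

/-- The ordered monomial with exponents `α` along a list of indices. -/
def powProd {A ι : Type*} [Ring A] (l : List ι) (y : ι → A) (α : ι → ℕ) : A :=
  (l.map fun i => y i ^ α i).prod

section PowProd

variable {k : Type*} [Field k] {A ι : Type*} [Ring A] [Algebra k A] {y : ι → A}

@[simp] lemma powProd_nil (α : ι → ℕ) : powProd [] y α = 1 := rfl

@[simp] lemma powProd_cons (i : ι) (l : List ι) (α : ι → ℕ) :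
    powProd (i :: l) y α = y i ^ α i * powProd l y α := by
  simp [powProd]

lemma powProd_congr {l : List ι} {α α' : ι → ℕ} (h : ∀ i ∈ l, α i = α' i) :
    powProd l y α = powProd l y α' := by
  unfold powProd
  congr 1
  exact List.map_congr_left fun i hi => by rw [h i hi]

@[simp] lemma powProd_zero (l : List ι) : powProd l y 0 = 1 := by
  induction l with
  | nil => rfl
  | cons i l ih => simp [ih]

lemma ScalarCommute.powProd_right {a : A} {l : List ι} (h : ∀ i ∈ l, ScalarCommute k a (y i))
    (α : ι → ℕ) : ScalarCommute k a (powProd l y α) := by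
  induction l with
  | nil => exact ScalarCommute.one_right a
  | cons i l ih =>
    rw [powProd_cons]
    exact ((h i (by simp)).pow_right _).mul_right (ih fun i' hi' => h i' (by simp [hi']))

lemma mul_powProd [DecidableEq ι] (hy : ∀ i i', ScalarCommute k (y i) (y i')) {l : List ι}
    (hl : l.Nodup) {i : ι} (hi : i ∈ l) (α : ι → ℕ) :
    ∃ u : k, u ≠ 0 ∧ y i * powProd l y α = u • powProd l y (α + Pi.single i 1) := by
  induction l with
  | nil => simp at hi
  | cons i' l ih =>
    obtain ⟨hi'l, hl⟩ := List.nodup_cons.1 hl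
    rw [powProd_cons, powProd_cons]
    by_cases h : i = i'
    · subst h
      refine ⟨1, one_ne_zero, ?_⟩
      rw [← mul_assoc, ← pow_succ', one_smul, powProd_congr (l := l) (α := α + Pi.single i 1)
        (α' := α) fun j hj => ?_]
      · simp
      · have : j ≠ i := fun h => hi'l (h ▸ hj)
        simp [this]
    · obtain ⟨u, hu, hu'⟩ := ih hl ((List.mem_cons.1 hi).resolve_left h)
      obtain ⟨v, hv, hv'⟩ := (hy i i').pow_right (α i')
      refine ⟨v * u, mul_ne_zero hv hu, ?_⟩
      have : (Pi.single i 1 : ι → ℕ) i' = 0 := by simp [Ne.symm h]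
      rw [← mul_assoc, hv', smul_mul_assoc, mul_assoc, hu', mul_smul_comm, smul_smul,
        Pi.add_apply, this, add_zero]

lemma weyl_mul_pow {a b : A} (h : a * b = b * a + 1) (n : ℕ) :
    a * b ^ n = b ^ n * a + (n : k) • b ^ (n - 1) := by
  induction n with
  | zero => simp
  | succ n ih =>
    rw [pow_succ, ← mul_assoc, ih, add_mul, mul_assoc, h, mul_add, mul_one, smul_mul_assoc]
    rcases n with _ | n
    · simp
    · rw [Nat.add_sub_cancel, Nat.add_sub_cancel, ← pow_succ, Nat.cast_succ (n + 1), add_smul,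
        one_smul, mul_assoc, add_assoc, add_comm (b ^ (n + 1))]

lemma weyl_mul_powProd [DecidableEq ι] {a : A} {i₀ : ι}
    (hne : ∀ i, i₀ ≠ i → ScalarCommute k a (y i)) (hsame : a * y i₀ = y i₀ * a + 1)
    {l : List ι} (hl : l.Nodup) (α : ι → ℕ) :
    ∃ u v : k, a * powProd l y α =
      u • (powProd l y α * a) + v • powProd l y (α - Pi.single i₀ 1) := by
  induction l with
  | nil => exact ⟨1, 0, by simp⟩
  | cons i l ih =>
    obtain ⟨hil, hl⟩ := List.nodup_cons.1 hl
    rw [powProd_cons, powProd_cons]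
    by_cases h : i₀ = i
    · subst h
      obtain ⟨u, hu, hu'⟩ := ScalarCommute.powProd_right (k := k) (a := a) (y := y) (l := l)
        (fun i hi => hne i fun h => hil (h ▸ hi)) α
      refine ⟨u, α i₀, ?_⟩
      rw [← mul_assoc, weyl_mul_pow (k := k) hsame, add_mul, mul_assoc, hu', mul_smul_comm,
        ← mul_assoc, smul_mul_assoc]
      congr 3
      · simp
      · refine powProd_congr fun j hj => ?_
        have : j ≠ i₀ := fun h => hil (h ▸ hj)
        simp [this]
    · obtain ⟨u, v, huv⟩ := ih hl
      obtain ⟨t, ht, ht'⟩ := (hne i h).pow_right (α i)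
      refine ⟨t * u, t * v, ?_⟩
      have : (Pi.single i₀ 1 : ι → ℕ) i = 0 := by simp [Ne.symm h]
      rw [← mul_assoc, ht', smul_mul_assoc, mul_assoc, huv, mul_add, smul_add, mul_smul_comm,
        mul_smul_comm, smul_smul, smul_smul, mul_assoc, Pi.sub_apply, this, Nat.sub_zero]

end PowProd

namespace QuasiWeylGenerators

variable {k : Type*} [Field k] {A ι J : Type*} [Ring A] [Algebra k A] [Fintype ι] [Fintype J]
  {e : J → ι} {y : ι → A} {x : J → A}

/-- The ordered monomial `y^α x^β`. -/
noncomputable def monom (y : ι → A) (x : J → A) (α : ι → ℕ) (β : J → ℕ) : A :=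
  powProd Finset.univ.toList y α * powProd Finset.univ.toList x β

/-- The span of the ordered monomials of degree at most `N`. -/
noncomputable def filtration (k : Type*) [Field k] [Algebra k A] (y : ι → A) (x : J → A) (N : ℕ) :
    Submodule k A :=
  Submodule.span k {a | ∃ α β, ∑ i, α i + ∑ j, β j ≤ N ∧ monom y x α β = a}

lemma monom_mem_filtration (y : ι → A) (x : J → A) {α : ι → ℕ} {β : J → ℕ} {N : ℕ}
    (h : ∑ i, α i + ∑ j, β j ≤ N) : monom y x α β ∈ filtration k y x N :=
  Submodule.subset_span ⟨α, β, h, rfl⟩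

lemma one_mem_filtration (y : ι → A) (x : J → A) : 1 ∈ filtration k y x 0 := by
  have := monom_mem_filtration (k := k) y x (α := 0) (β := 0) (N := 0) (by simp)
  simpa [monom] using this

lemma filtration_mono (y : ι → A) (x : J → A) {N M : ℕ} (h : N ≤ M) :
    filtration k y x N ≤ filtration k y x M :=
  Submodule.span_mono fun _ ⟨α, β, hN, ha⟩ => ⟨α, β, hN.trans h, ha⟩

lemma mul_mem_of_monom {z : A} {N M : ℕ}
    (h : ∀ α β, ∑ i, α i + ∑ j, β j ≤ N → z * monom y x α β ∈ filtration k y x M)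
    {b : A} (hb : b ∈ filtration k y x N) : z * b ∈ filtration k y x M := by
  induction hb using Submodule.span_induction with
  | mem b hb => obtain ⟨α, β, hN, rfl⟩ := hb; exact h α β hN
  | zero => simp
  | add b b' _ _ hb hb' => rw [mul_add]; exact add_mem hb hb'
  | smul r b _ hb => rw [mul_smul_comm]; exact Submodule.smul_mem _ _ hb

variable (h : QuasiWeylGenerators k e y x)
include h

lemma y_mul_mem (i : ι) {N : ℕ} {b : A} (hb : b ∈ filtration k y x N) :
    y i * b ∈ filtration k y x (N + 1) := by
  classical
  refine mul_mem_of_monom (fun α β hN => ?_) hb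
  obtain ⟨u, -, hu⟩ := mul_powProd h.yy (Finset.nodup_toList Finset.univ) (i := i) (by simp) α
  rw [monom, ← mul_assoc, hu, smul_mul_assoc]
  refine Submodule.smul_mem _ _ (monom_mem_filtration y x ?_)
  simp only [Pi.add_apply, Finset.sum_add_distrib, Finset.sum_pi_single', Finset.mem_univ, if_true]
  lia

lemma x_mul_mem (j : J) {N : ℕ} {b : A} (hb : b ∈ filtration k y x N) :
    x j * b ∈ filtration k y x (N + 1) := by
  classical
  refine mul_mem_of_monom (fun α β hN => ?_) hb
  obtain ⟨u, v, huv⟩ := weyl_mul_powProd (h.xy_ne j) (h.xy_same j)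
    (Finset.nodup_toList Finset.univ) α
  obtain ⟨t, -, ht⟩ := mul_powProd h.xx (Finset.nodup_toList Finset.univ) (i := j) (by simp) β
  rw [monom, ← mul_assoc, huv, add_mul, smul_mul_assoc, mul_assoc, ht, mul_smul_comm, smul_smul,
    smul_mul_assoc]
  refine add_mem (Submodule.smul_mem _ _ (monom_mem_filtration y x ?_))
    (Submodule.smul_mem _ _ (monom_mem_filtration y x ?_))
  · simp only [Pi.add_apply, Finset.sum_add_distrib, Finset.sum_pi_single', Finset.mem_univ,
      if_true]
    lia
  · have : ∑ i, (α - Pi.single (e j) 1 : ι → ℕ) i ≤ ∑ i, α i := Finset.sum_le_sum fun i _ => by simp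
    lia

omit h in
lemma powProd_mul_mem {κ : Type*} {g : κ → A}
    (hg : ∀ i {N : ℕ} {b : A}, b ∈ filtration k y x N → g i * b ∈ filtration k y x (N + 1))
    (l : List κ) (α : κ → ℕ) {N : ℕ} {b : A} (hb : b ∈ filtration k y x N) :
    powProd l g α * b ∈ filtration k y x ((l.map α).sum + N) := by
  have hpow : ∀ (i : κ) (n : ℕ) {N : ℕ} {b : A}, b ∈ filtration k y x N →
      g i ^ n * b ∈ filtration k y x (n + N) := by
    intro i n
    induction n with
    | zero => intro N b hb; simpa using hb
    | succ n ih =>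
      intro N b hb
      rw [pow_succ, mul_assoc, add_assoc, add_comm 1]
      exact ih (hg i hb)
  induction l with
  | nil => simpa using hb
  | cons i l ih =>
    rw [powProd_cons, mul_assoc, List.map_cons, List.sum_cons, add_assoc]
    exact hpow i _ ih

lemma mul_mem_filtration {N M : ℕ} {a b : A} (ha : a ∈ filtration k y x N)
    (hb : b ∈ filtration k y x M) : a * b ∈ filtration k y x (N + M) := by
  induction ha using Submodule.span_induction with
  | mem a ha =>
    obtain ⟨α, β, hN, rfl⟩ := ha
    rw [monom, mul_assoc]
    refine filtration_mono y x ?_ (powProd_mul_mem h.y_mul_mem _ α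
      (powProd_mul_mem h.x_mul_mem _ β hb))
    simp only [Finset.sum_map_toList]
    lia
  | zero => simp
  | add a a' _ _ ha ha' => rw [add_mul]; exact add_mem ha ha'
  | smul r a _ ha => rw [smul_mul_assoc]; exact Submodule.smul_mem _ _ ha

lemma exists_mem_filtration (a : A) : ∃ N, a ∈ filtration k y x N := by
  have ha : a ∈ Algebra.adjoin k (Set.range y ∪ Set.range x) := h.adjoin_eq_top ▸ Algebra.mem_top
  induction ha using Algebra.adjoin_induction with
  | mem a ha =>
    refine ⟨1, ?_⟩
    rcases ha with ⟨i, rfl⟩ | ⟨j, rfl⟩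
    · simpa using h.y_mul_mem i (one_mem_filtration y x)
    · simpa using h.x_mul_mem j (one_mem_filtration y x)
  | algebraMap r =>
    refine ⟨0, ?_⟩
    rw [Algebra.algebraMap_eq_smul_one]
    exact Submodule.smul_mem _ _ (one_mem_filtration y x)
  | add a a' _ _ ha ha' =>
    obtain ⟨N, hN⟩ := ha
    obtain ⟨M, hM⟩ := ha'
    exact ⟨max N M, add_mem (filtration_mono y x (le_max_left _ _) hN)
      (filtration_mono y x (le_max_right _ _) hM)⟩
  | mul a a' _ _ ha ha' =>
    obtain ⟨N, hN⟩ := ha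
    obtain ⟨M, hM⟩ := ha'
    exact ⟨N + M, h.mul_mem_filtration hN hM⟩

omit h in
lemma filtration_eq_span_image (y : ι → A) (x : J → A) (N : ℕ) :
    ∃ s : Finset A, s.card ≤ (N + 1) ^ (Fintype.card ι + Fintype.card J) ∧
      filtration k y x N ≤ Submodule.span k (s : Set A) := by
  classical
  refine ⟨((Fintype.piFinset fun _ : ι => Finset.range (N + 1)) ×ˢ
    (Fintype.piFinset fun _ : J => Finset.range (N + 1))).image fun p => monom y x p.1 p.2, ?_, ?_⟩
  · refine Finset.card_image_le.trans ?_
    simp [Finset.card_product, Fintype.card_piFinset, pow_add]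
  · refine Submodule.span_mono ?_
    rintro _ ⟨α, β, hN, rfl⟩
    simp only [Finset.coe_image, Set.mem_image, Finset.mem_coe, Finset.mem_product,
      Fintype.mem_piFinset, Finset.mem_range]
    refine ⟨(α, β), ⟨fun i => ?_, fun j => ?_⟩, rfl⟩
    · have := Finset.single_le_sum (f := α) (fun _ _ => Nat.zero_le _) (Finset.mem_univ i)
      dsimp only
      lia
    · have := Finset.single_le_sum (f := β) (fun _ _ => Nat.zero_le _) (Finset.mem_univ j)
      dsimp only
      lia

omit h in
lemma finiteDimensional_filtration (y : ι → A) (x : J → A) (N : ℕ) :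
    FiniteDimensional k (filtration k y x N) := by
  obtain ⟨s, -, hs⟩ := filtration_eq_span_image (k := k) y x N
  have := FiniteDimensional.span_finset k s
  exact Submodule.finiteDimensional_of_le hs

omit h in
lemma finrank_filtration_le (y : ι → A) (x : J → A) (N : ℕ) :
    Module.finrank k (filtration k y x N) ≤ (N + 1) ^ (Fintype.card ι + Fintype.card J) := by
  obtain ⟨s, hcard, hs⟩ := filtration_eq_span_image (k := k) y x N
  have := FiniteDimensional.span_finset k s
  exact (Submodule.finrank_mono hs).trans ((finrank_span_finset_le_card s).trans hcard)

end QuasiWeylGenerators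

/-- A sequence that doubles at bounded steps is not polynomially bounded. -/
lemma not_doubling_of_le_pow {f : ℕ → ℕ} {C d : ℕ} (h₀ : 1 ≤ f 0)
    (hdouble : ∀ N, 2 * f N ≤ f (N + C)) (hle : ∀ N, f N ≤ (N + 1) ^ d) : False := by
  have hpow : ∀ n, 2 ^ n ≤ f (n * C) := by
    intro n
    induction n with
    | zero => simpa using h₀
    | succ n ih =>
      have := hdouble (n * C)
      rw [Nat.succ_mul, pow_succ]
      lia
  have hlim := (tendsto_pow_const_div_const_pow_of_one_lt d (one_lt_two (α := ℝ))).const_mul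
    (((C : ℝ) + 1) ^ d)
  rw [mul_zero] at hlim
  obtain ⟨n, hn, hn1⟩ := ((hlim.eventually_lt_const one_pos).and
    (Filter.eventually_ge_atTop 1)).exists
  rw [← mul_div_assoc, div_lt_one (by positivity), ← mul_pow] at hn
  have h1 := (hpow n).trans (hle (n * C))
  have h2 : (n * C + 1) ^ d ≤ ((C + 1) * n) ^ d := Nat.pow_le_pow_left (by nlinarith) d
  have h3 : ((2 ^ n : ℕ) : ℝ) ≤ (((C + 1) * n) ^ d : ℕ) := by exact_mod_cast h1.trans h2
  push_cast at h3
  linarith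

namespace QuasiWeylGenerators

variable {k : Type*} [Field k] {A ι J : Type*} [Ring A] [Algebra k A] [Fintype ι] [Fintype J]
  {e : J → ι} {y : ι → A} {x : J → A}

lemma exists_filtration_common (h : QuasiWeylGenerators k e y x) (a b : A) :
    ∃ N, a ∈ filtration k y x N ∧ b ∈ filtration k y x N := by
  obtain ⟨N, hN⟩ := h.exists_mem_filtration a
  obtain ⟨M, hM⟩ := h.exists_mem_filtration b
  exact ⟨max N M, filtration_mono y x (le_max_left _ _) hN,
    filtration_mono y x (le_max_right _ _) hM⟩

lemma not_injective_of_map_filtration [Nontrivial A] (φ : A × A →ₗ[k] A) {C : ℕ}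
    (hφ : ∀ N, ∀ a ∈ filtration k y x N, ∀ b ∈ filtration k y x N,
      φ (a, b) ∈ filtration k y x (N + C)) : ¬ Function.Injective φ := by
  intro hinj
  refine not_doubling_of_le_pow (f := fun N => Module.finrank k (filtration k y x N)) (C := C) ?_
    (fun N => ?_) (finrank_filtration_le y x)
  · have := finiteDimensional_filtration (k := k) y x 0
    have : Nontrivial (filtration k y x 0) :=
      ⟨⟨1, one_mem_filtration y x⟩, 0, fun h => one_ne_zero (congrArg Subtype.val h)⟩
    exact Module.finrank_pos
  · have := finiteDimensional_filtration (k := k) y x N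
    have := finiteDimensional_filtration (k := k) y x (N + C)
    let ψ : (filtration k y x N × filtration k y x N) →ₗ[k] filtration k y x (N + C) :=
      (φ.comp ((filtration k y x N).subtype.prodMap (filtration k y x N).subtype)).codRestrict _
        fun p => hφ N _ p.1.2 _ p.2.2
    have hψ : Function.Injective ψ := by
      intro p p' hp
      have := hinj (congrArg Subtype.val hp)
      simp only [LinearMap.prodMap_apply, Submodule.subtype_apply, Prod.mk.injEq] at this
      exact Prod.ext (Subtype.ext this.1) (Subtype.ext this.2)
    have := LinearMap.finrank_le_finrank_of_injective hψ
    rwa [Module.finrank_prod, ← two_mul] at this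

lemma exists_right_ore [NoZeroDivisors A] [Nontrivial A] (h : QuasiWeylGenerators k e y x)
    (a b : A) (hb : b ≠ 0) : ∃ c d : A, d ≠ 0 ∧ a * d = b * c := by
  by_contra! hcon
  obtain ⟨C, ha, hb'⟩ := h.exists_filtration_common a b
  refine not_injective_of_map_filtration (y := y) (x := x) (C := C)
    ((LinearMap.mulLeft k a).comp (LinearMap.fst k A A) -
      (LinearMap.mulLeft k b).comp (LinearMap.snd k A A)) (fun N d hd c hc => ?_) ?_
  · rw [add_comm N]
    exact sub_mem (h.mul_mem_filtration ha hd) (h.mul_mem_filtration hb' hc)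
  · refine (injective_iff_map_eq_zero _).2 fun ⟨d, c⟩ hdc => ?_
    have heq : a * d = b * c := by simpa [sub_eq_zero] using hdc
    have hd : d = 0 := by
      by_contra hd
      exact hcon c d hd heq
    rw [hd, mul_zero, eq_comm, mul_eq_zero] at heq
    rw [hd, heq.resolve_left hb, Prod.mk_zero_zero]

lemma exists_left_ore [NoZeroDivisors A] [Nontrivial A] (h : QuasiWeylGenerators k e y x)
    (a b : A) (hb : b ≠ 0) : ∃ c d : A, d ≠ 0 ∧ d * a = c * b := by
  by_contra! hcon
  obtain ⟨C, ha, hb'⟩ := h.exists_filtration_common a b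
  refine not_injective_of_map_filtration (y := y) (x := x) (C := C)
    ((LinearMap.mulRight k a).comp (LinearMap.fst k A A) -
      (LinearMap.mulRight k b).comp (LinearMap.snd k A A)) (fun N d hd c hc => ?_) ?_
  · exact sub_mem (h.mul_mem_filtration hd ha) (h.mul_mem_filtration hc hb')
  · refine (injective_iff_map_eq_zero _).2 fun ⟨d, c⟩ hdc => ?_
    have heq : d * a = c * b := by simpa [sub_eq_zero] using hdc
    have hd : d = 0 := by
      by_contra hd
      exact hcon c d hd heq
    rw [hd, zero_mul, eq_comm, mul_eq_zero] at heq
    rw [hd, heq.resolve_right hb, Prod.mk_zero_zero]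

end QuasiWeylGenerators

namespace CrossedLaurent

open MvPolynomial

section Leading

variable {k J : Type*} [Field k]

/-- The polynomials which are products of a nonzero constant and of translates of the variables,
with `β` counting the variables. -/
inductive IsLinearProduct : (J →₀ ℕ) → MvPolynomial J k → Prop
  | const (u : k) (hu : u ≠ 0) : IsLinearProduct 0 (C u)
  | linear_mul (j : J) (a : k) {β : J →₀ ℕ} {p : MvPolynomial J k} (hp : IsLinearProduct β p) :
      IsLinearProduct (β + Finsupp.single j 1) ((X j + C a) * p)

lemma IsLinearProduct.C_mul {β : J →₀ ℕ} {p : MvPolynomial J k} (hp : IsLinearProduct β p)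
    {u : k} (hu : u ≠ 0) : IsLinearProduct β (C u * p) := by
  induction hp with
  | const v hv => rw [← map_mul]; exact .const _ (mul_ne_zero hu hv)
  | linear_mul j a hp ih => rw [mul_left_comm]; exact .linear_mul j a ih

lemma IsLinearProduct.shift {Γ : Type*} [AddCommGroup Γ] (δ : J → Γ →+ ℤ) (b : Γ)
    {β : J →₀ ℕ} {p : MvPolynomial J k} (hp : IsLinearProduct β p) :
    IsLinearProduct β (shift δ k b p) := by
  induction hp with
  | const v hv => rw [shift_C]; exact .const _ hv
  | linear_mul j a hp ih =>
    have : CrossedLaurent.shift δ k b (X j + C a) = X j + C (a - (δ j b : ℤ)) := by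
      rw [map_add, shift_X, shift_C, C_sub]
      ring
    rw [map_mul, this]
    exact .linear_mul j _ ih

lemma IsLinearProduct.coeff_ne_zero {β : J →₀ ℕ} {p : MvPolynomial J k}
    (hp : IsLinearProduct β p) :
    p.coeff β ≠ 0 ∧ ∀ β', p.coeff β' ≠ 0 → β' ≤ β := by
  classical
  induction hp with
  | const u hu =>
    refine ⟨by simpa using hu, fun β' h => ?_⟩
    rw [coeff_C] at h
    have : 0 = β' := by
      by_contra hne
      exact h (if_neg hne)
    exact this.ge
  | linear_mul j a hp ih =>
    rename_i β p
    constructor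
    · have h0 : p.coeff (β + Finsupp.single j 1) = 0 := by
        by_contra hne
        have := ih.2 _ hne j
        simp at this
      rw [add_mul, MvPolynomial.coeff_add, coeff_C_mul, h0, mul_zero, add_zero, mul_comm,
        coeff_mul_X]
      exact ih.1
    · intro β' h
      rw [add_mul, MvPolynomial.coeff_add, coeff_C_mul, mul_comm, coeff_mul_X'] at h
      by_cases h1 : p.coeff β' = 0
      · rw [h1, mul_zero, add_zero] at h
        split_ifs at h with hj
        · have := ih.2 _ h
          intro i
          have h2 := this i
          rw [Finsupp.tsub_apply] at h2
          rw [Finsupp.add_apply]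
          lia
        · exact absurd rfl h
      · exact (ih.2 _ h1).trans le_self_add

end Leading

section Injective

variable {k : Type*} [Field k] {Γ J ι A : Type*} [AddCommGroup Γ] [Ring A] [Algebra k A]
  {δ : J → Γ →+ ℤ} {c : Γ →+ Γ →+ Additive kˣ}

/-- A homogeneous element whose coefficient is a product of translates of variables. -/
def IsLeadingTerm (γ : Γ) (β : J →₀ ℕ) (b : CrossedLaurent δ c) : Prop :=
  ∃ p, IsLinearProduct β p ∧ b = single δ c γ p

lemma IsLeadingTerm.mul {γ γ' : Γ} {β : J →₀ ℕ} {b : CrossedLaurent δ c}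
    (hb : IsLeadingTerm γ β b) {u : k} (hu : u ≠ 0) :
    IsLeadingTerm (γ' + γ) β (single δ c γ' (C u) * b) := by
  obtain ⟨p, hp, rfl⟩ := hb
  refine ⟨_, ?_, single_mul_single _ _ _ _⟩
  exact ((hp.shift δ γ').C_mul hu).C_mul (Units.ne_zero _)

lemma IsLeadingTerm.mul_X {γ γ' : Γ} {β : J →₀ ℕ} {b : CrossedLaurent δ c}
    (hb : IsLeadingTerm γ β b) {u : k} (hu : u ≠ 0) (j : J) :
    IsLeadingTerm (γ' + γ) (β + Finsupp.single j 1) (single δ c γ' (C u * X j) * b) := by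
  obtain ⟨p, hp, rfl⟩ := hb
  refine ⟨_, ?_, single_mul_single _ _ _ _⟩
  have := (((hp.shift δ γ').linear_mul j 0).C_mul hu).C_mul (Units.ne_zero (c γ' γ).toMul)
  rwa [C_0, add_zero, ← mul_assoc (C u)] at this

lemma IsLeadingTerm.powProd_mul {κ : Type*} {g : κ → CrossedLaurent δ c} {θ : κ → Γ}
    {η : κ → (J →₀ ℕ)}
    (hg : ∀ i γ β b, IsLeadingTerm γ β b → IsLeadingTerm (θ i + γ) (β + η i) (g i * b))
    (l : List κ) (α : κ → ℕ) {γ : Γ} {β : J →₀ ℕ} {b : CrossedLaurent δ c}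
    (hb : IsLeadingTerm γ β b) :
    IsLeadingTerm ((l.map fun i => α i • θ i).sum + γ) (β + (l.map fun i => α i • η i).sum)
      (powProd l g α * b) := by
  have hpow : ∀ (i : κ) (n : ℕ) {γ : Γ} {β : J →₀ ℕ} {b : CrossedLaurent δ c},
      IsLeadingTerm γ β b → IsLeadingTerm (n • θ i + γ) (β + n • η i) (g i ^ n * b) := by
    intro i n
    induction n with
    | zero => intro γ β b hb; simpa using hb
    | succ n ih =>
      intro γ β b hb
      have := ih (hg i _ _ _ hb)
      rwa [pow_succ, mul_assoc, succ_nsmul, succ_nsmul, add_assoc, add_comm (n • η i),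
        ← add_assoc β]
  induction l with
  | nil => simpa using hb
  | cons i l ih =>
    rw [powProd_cons, mul_assoc, List.map_cons, List.map_cons, List.sum_cons, List.sum_cons,
      add_assoc, add_comm (α i • η i), ← add_assoc β]
    exact hpow i _ ih

lemma map_powProd {B κ : Type*} [Ring B] [Algebra k B] (f : A →ₐ[k] B) (l : List κ) (g : κ → A)
    (α : κ → ℕ) : f (powProd l g α) = powProd l (f ∘ g) α := by
  induction l with
  | nil => simp
  | cons i l ih => simp [ih]

variable [Fintype ι] [Fintype J] {e : J → ι} {y : ι → A} {x : J → A}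

/-- A homomorphism to a twisted Laurent polynomial ring is injective if it sends the generators to
suitable homogeneous elements with independent degrees. -/
lemma injective_of_generators (h : QuasiWeylGenerators k e y x) (f : A →ₐ[k] CrossedLaurent δ c)
    (θ : ι → Γ) (hy : ∀ i, ∃ u : k, u ≠ 0 ∧ f (y i) = single δ c (θ i) (C u))
    (hx : ∀ j, ∃ u : k, u ≠ 0 ∧ f (x j) = single δ c (-θ (e j)) (C u * X j))
    (hθ : Function.Injective fun α : ι → ℕ => ∑ i, α i • θ i) : Function.Injective f := by
  classical
  have hmonom : ∀ (α : ι → ℕ) (β : J → ℕ), IsLeadingTerm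
      (∑ i, α i • θ i + ∑ j, β j • (-θ (e j))) (Finsupp.equivFunOnFinite.symm β)
      (f (QuasiWeylGenerators.monom y x α β)) := by
    intro α β
    have h1 : IsLeadingTerm (0 : Γ) (0 : J →₀ ℕ) (1 : CrossedLaurent δ c) :=
      ⟨1, IsLinearProduct.const 1 one_ne_zero, one_def⟩
    have h2 := IsLeadingTerm.powProd_mul (g := f ∘ x) (θ := fun j => -θ (e j))
      (η := fun j => Finsupp.single j 1) (fun j γ β b hb => by
        obtain ⟨u, hu, hu'⟩ := hx j
        simp only [Function.comp_apply, hu']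
        exact hb.mul_X hu j) Finset.univ.toList β h1
    have h3 := IsLeadingTerm.powProd_mul (g := f ∘ y) (θ := θ)
      (η := fun _ => 0) (fun j γ β b hb => by
        obtain ⟨u, hu, hu'⟩ := hy j
        simp only [Function.comp_apply, hu', add_zero]
        exact hb.mul hu) Finset.univ.toList α h2
    rw [mul_one, ← map_powProd, ← map_powProd, ← map_mul] at h3
    simp only [Finset.sum_map_toList, smul_zero, Finset.sum_const_zero, add_zero, zero_add] at h3
    convert h3 using 1
    · ext j
      simp [Finsupp.finsetSum_apply, Finsupp.single_apply]
    · rfl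
  refine (injective_iff_map_eq_zero f).2 fun a ha => ?_
  have hspan : a ∈ Submodule.span k (Set.range fun p : (ι → ℕ) × (J → ℕ) =>
      QuasiWeylGenerators.monom y x p.1 p.2) := by
    obtain ⟨N, hN⟩ := h.exists_mem_filtration a
    refine Submodule.span_mono ?_ hN
    rintro _ ⟨α, β, -, rfl⟩
    exact ⟨(α, β), rfl⟩
  obtain ⟨s, rfl⟩ := (Finsupp.mem_span_range_iff_exists_finsupp).1 hspan
  by_contra hne
  have hs : s.support.Nonempty := by
    rw [Finsupp.support_nonempty_iff]
    rintro rfl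
    simp at hne
  obtain ⟨⟨α₀, β₀⟩, h₀, hmax⟩ := Finset.exists_max_image s.support (fun p => ∑ j, p.2 j) hs
  refine Finsupp.mem_support_iff.1 h₀ ?_
  have key := congrArg (fun b => ((b.coeff (∑ i, α₀ i • θ i + ∑ j, β₀ j • (-θ (e j))))).coeff
    (Finsupp.equivFunOnFinite.symm β₀)) ha
  simp only [Finsupp.sum, map_sum, coeff_sum, map_smul, CrossedLaurent.coeff_smul,
    CrossedLaurent.coeff_zero, MvPolynomial.coeff_sum, MvPolynomial.coeff_smul,
    MvPolynomial.coeff_zero] at key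
  rw [Finset.sum_eq_single (α₀, β₀)] at key
  · obtain ⟨p, hp, hp'⟩ := hmonom α₀ β₀
    rw [hp', coeff_single, if_pos rfl, smul_eq_mul, mul_eq_zero] at key
    exact key.resolve_right hp.coeff_ne_zero.1
  · rintro ⟨α, β⟩ hαβ hne'
    obtain ⟨p, hp, hp'⟩ := hmonom α β
    rw [hp', coeff_single]
    split_ifs with hdeg
    · rw [smul_eq_mul, mul_eq_zero]
      right
      by_contra hcoeff
      have hle : β₀ ≤ β := fun j => hp.coeff_ne_zero.2 _ hcoeff j
      have hβ : β₀ = β := by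
        have h1 := hmax _ hαβ
        have h2 := (Finset.sum_eq_sum_iff_of_le (s := Finset.univ) fun j _ => hle j).1
          (le_antisymm (Finset.sum_le_sum fun j _ => hle j) h1)
        exact funext fun j => h2 j (Finset.mem_univ j)
      subst hβ
      exact hne' (by rw [hθ (add_right_cancel hdeg)])
    · simp
  · exact fun hn => absurd h₀ hn

end Injective

end CrossedLaurent

namespace MixedCrossedAlgebra

variable {k : Type u} [Field k] {n : ℕ} {Λ : Matrix (Fin n) (Fin n) k} {r : ℕ} {hr : r ≤ n}

lemma y_mul_y (i j : Fin n) :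
    y k Λ r hr i * y k Λ r hr j = Λ i j • (y k Λ r hr j * y k Λ r hr i) := by
  have := RingQuot.mkAlgHom_rel k (MixedCrossedRel.yy (k := k) (Λ := Λ) (r := r) (hr := hr) i j)
  rw [map_mul, map_mul, AlgHom.commutes, map_mul, ← Algebra.smul_def] at this
  exact this

lemma x_mul_y_same (i : Fin r) :
    x k Λ r hr i * y k Λ r hr (Fin.castLE hr i) =
      y k Λ r hr (Fin.castLE hr i) * x k Λ r hr i + 1 := by
  have := RingQuot.mkAlgHom_rel k (MixedCrossedRel.xy_same (k := k) (Λ := Λ) (hr := hr) i)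
  rw [map_mul, map_add, map_mul, map_one] at this
  exact this

lemma x_mul_y_ne (i : Fin r) (j : Fin n) (hij : Fin.castLE hr i ≠ j) :
    x k Λ r hr i * y k Λ r hr j =
      (Λ (Fin.castLE hr i) j)⁻¹ • (y k Λ r hr j * x k Λ r hr i) := by
  have := RingQuot.mkAlgHom_rel k (MixedCrossedRel.xy_ne (k := k) (Λ := Λ) (hr := hr) i j hij)
  rw [map_mul, map_mul, AlgHom.commutes, map_mul, ← Algebra.smul_def] at this
  exact this

lemma x_mul_x (i j : Fin r) :
    x k Λ r hr i * x k Λ r hr j =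
      Λ (Fin.castLE hr i) (Fin.castLE hr j) • (x k Λ r hr j * x k Λ r hr i) := by
  have := RingQuot.mkAlgHom_rel k (MixedCrossedRel.xx (k := k) (Λ := Λ) (hr := hr) i j)
  rw [map_mul, map_mul, AlgHom.commutes, map_mul, ← Algebra.smul_def] at this
  exact this

lemma adjoin_generators :
    Algebra.adjoin k (Set.range (y k Λ r hr) ∪ Set.range (x k Λ r hr)) = ⊤ := by
  have h := congrArg (Subalgebra.map (RingQuot.mkAlgHom k (MixedCrossedRel k Λ r hr)))
    (FreeAlgebra.adjoin_range_ι k (Fin n ⊕ Fin r))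
  rw [AlgHom.map_adjoin, Algebra.map_top,
    (AlgHom.range_eq_top _).2 (RingQuot.mkAlgHom_surjective k _)] at h
  refine (congrArg (Algebra.adjoin k) ?_).trans h
  rw [← Set.range_comp, ← Set.Sum.elim_range]
  congr 1
  funext a
  rcases a with a | a <;> rfl

lemma quasiWeylGenerators (hΛ : Λ.MulAntisymmetric) :
    QuasiWeylGenerators k (Fin.castLE hr) (y k Λ r hr) (x k Λ r hr) where
  yy i j := ⟨_, left_ne_zero_of_mul_eq_one (hΛ.2 i j), y_mul_y i j⟩
  xx i j := ⟨_, left_ne_zero_of_mul_eq_one (hΛ.2 _ _), x_mul_x i j⟩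
  xy_ne i j hij := ⟨_, inv_ne_zero (left_ne_zero_of_mul_eq_one (hΛ.2 _ _)), x_mul_y_ne i j hij⟩
  xy_same := x_mul_y_same
  adjoin_eq_top := adjoin_generators

lemma exists_lift {B : Type*} [Ring B] [Algebra k B] (Y : Fin n → B) (X : Fin r → B)
    (yy : ∀ i j, Y i * Y j = Λ i j • (Y j * Y i))
    (xy_same : ∀ i, X i * Y (Fin.castLE hr i) = Y (Fin.castLE hr i) * X i + 1)
    (xy_ne : ∀ i j, Fin.castLE hr i ≠ j →
      X i * Y j = (Λ (Fin.castLE hr i) j)⁻¹ • (Y j * X i))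
    (xx : ∀ i j, X i * X j = Λ (Fin.castLE hr i) (Fin.castLE hr j) • (X j * X i)) :
    ∃ f : MixedCrossedAlgebra k Λ r hr →ₐ[k] B,
      (∀ i, f (y k Λ r hr i) = Y i) ∧ ∀ i, f (x k Λ r hr i) = X i := by
  have hrel : ∀ ⦃a b⦄, MixedCrossedRel k Λ r hr a b →
      FreeAlgebra.lift k (Sum.elim Y X) a = FreeAlgebra.lift k (Sum.elim Y X) b := by
    intro a b hab
    induction hab with
    | yy i j => simpa [Algebra.smul_def] using yy i j
    | xy_same i => simpa [Algebra.smul_def] using xy_same i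
    | xy_ne i j hij => simpa [Algebra.smul_def] using xy_ne i j hij
    | xx i j => simpa [Algebra.smul_def] using xx i j
  refine ⟨RingQuot.liftAlgHom k ⟨FreeAlgebra.lift k (Sum.elim Y X), hrel⟩, fun i => ?_,
    fun i => ?_⟩
  · exact (RingQuot.liftAlgHom_mkAlgHom_apply k _ hrel _).trans (by simp)
  · exact (RingQuot.liftAlgHom_mkAlgHom_apply k _ hrel _).trans (by simp)

end MixedCrossedAlgebra

/-- The indices of the generators other than the `x_i`. -/
abbrev MWGen.Index (m n t : ℕ) : Type := Fin m ⊕ Fin n ⊕ Fin n ⊕ Fin t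

namespace MixedWeylAlgebra

variable {k : Type u} [Field k] {m n t : ℕ} {q : Fin n → k}

/-- The generators of `A_{m,n,t}^{q̄}(k)`. -/
noncomputable def gen (q : Fin n → k) (g : MWGen m n t) : MixedWeylAlgebra k m n t q :=
  RingQuot.mkAlgHom k (MWRel k m n t q) (FreeAlgebra.ι k g)

lemma weyl (i : Fin m) :
    (gen q (.x i) * gen q (.y i) : MixedWeylAlgebra k m n t q) =
      gen q (.y i) * gen q (.x i) + 1 := by
  have := RingQuot.mkAlgHom_rel k (MWRel.weyl (k := k) (t := t) (q := q) i)
  rw [map_mul, map_add, map_mul, map_one] at this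
  exact this

lemma quantum (i : Fin n) :
    (gen q (.u i) * gen q (.v i) : MixedWeylAlgebra k m n t q) =
      q i • (gen q (.v i) * gen q (.u i)) := by
  have := RingQuot.mkAlgHom_rel k (MWRel.quantum (k := k) (m := m) (t := t) (q := q) i)
  rw [map_mul, map_mul, AlgHom.commutes, map_mul, ← Algebra.smul_def] at this
  exact this

lemma commute {a b : MWGen m n t} (h : ¬ a.IsSpecialPair b) :
    gen q a * gen q b = gen q b * gen q a := by
  by_cases hab : a = b
  · rw [hab]
  · have := RingQuot.mkAlgHom_rel k (MWRel.comm (k := k) (q := q) a b hab h)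
    rw [map_mul, map_mul] at this
    exact this

/-- The generators other than the `x_i`. -/
noncomputable def y (q : Fin n → k) : MWGen.Index m n t → MixedWeylAlgebra k m n t q
  | .inl i => gen q (.y i)
  | .inr (.inl i) => gen q (.u i)
  | .inr (.inr (.inl i)) => gen q (.v i)
  | .inr (.inr (.inr i)) => gen q (.z i)

/-- The generators `x_i`. -/
noncomputable def x (q : Fin n → k) (i : Fin m) : MixedWeylAlgebra k m n t q := gen q (.x i)

lemma adjoin_range_gen : Algebra.adjoin k (Set.range (gen q : MWGen m n t → _)) = ⊤ := by
  have h := congrArg (Subalgebra.map (RingQuot.mkAlgHom k (MWRel k m n t q)))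
    (FreeAlgebra.adjoin_range_ι k (MWGen m n t))
  rw [AlgHom.map_adjoin, Algebra.map_top,
    (AlgHom.range_eq_top _).2 (RingQuot.mkAlgHom_surjective k _), ← Set.range_comp] at h
  exact h

lemma quasiWeylGenerators (hq : ∀ i, q i ≠ 0) :
    QuasiWeylGenerators k Sum.inl (y q : MWGen.Index m n t → _) (x q) where
  yy a b := by
    have hc : ∀ {a b : MWGen m n t}, ¬ a.IsSpecialPair b →
        ∃ u : k, u ≠ 0 ∧ gen q a * gen q b = u • (gen q b * gen q a) := fun h =>
      ⟨1, one_ne_zero, by rw [one_smul, commute h]⟩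
    rcases a with a | a | a | a <;> rcases b with b | b | b | b
    case inr.inl.inr.inr.inl =>
      by_cases hab : a = b
      · subst hab
        exact ⟨q a, hq a, quantum a⟩
      · exact hc hab
    case inr.inr.inl.inr.inl =>
      by_cases hab : a = b
      · subst hab
        exact ⟨(q a)⁻¹, inv_ne_zero (hq a), ((inv_smul_eq_iff₀ (hq a)).2 (quantum a)).symm⟩
      · exact hc hab
    all_goals exact hc (by simp [MWGen.IsSpecialPair])
  xx a b := ⟨1, one_ne_zero, by rw [one_smul, x, x, commute (by simp [MWGen.IsSpecialPair])]⟩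
  xy_ne j i hij := by
    refine ⟨1, one_ne_zero, ?_⟩
    rw [one_smul]
    rcases i with i | i | i | i
    · exact commute fun h : j = i => hij (congrArg _ h)
    all_goals exact commute (by simp [MWGen.IsSpecialPair])
  xy_same := weyl
  adjoin_eq_top := by
    rw [← adjoin_range_gen]
    congr 1
    ext a
    constructor
    · rintro (⟨i | i | i | i, rfl⟩ | ⟨i, rfl⟩) <;> exact ⟨_, rfl⟩
    · rintro ⟨i | i | i | i | i, rfl⟩
      · exact Or.inr ⟨i, rfl⟩
      · exact Or.inl ⟨.inl i, rfl⟩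
      · exact Or.inl ⟨.inr (.inl i), rfl⟩
      · exact Or.inl ⟨.inr (.inr (.inl i)), rfl⟩
      · exact Or.inl ⟨.inr (.inr (.inr i)), rfl⟩

open MvPolynomial CrossedLaurent

section Model

variable {R : Type*} [CommRing R] {m n t : ℕ}

lemma single_mul_single_comm {Γ J : Type*} [AddCommGroup Γ] {δ : J → Γ →+ ℤ}
    {c : Γ →+ Γ →+ Additive Rˣ} {a b : Γ} {p q : MvPolynomial J R} (hc : c a b = c b a)
    (h : p * shift δ R a q = q * shift δ R b p) :
    single δ c a p * single δ c b q = single δ c b q * single δ c a p := by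
  rw [single_mul_single, single_mul_single, hc, h, add_comm]

/-- The exponents of the variables `y_i`. -/
def weylDegree (m n t : ℕ) (i : Fin m) : (MWGen.Index m n t → ℤ) →+ ℤ :=
  Pi.evalAddMonoidHom _ (Sum.inl i)

@[simp] lemma weylDegree_apply (i : Fin m) (α : MWGen.Index m n t → ℤ) :
    weylDegree m n t i α = α (.inl i) := rfl

/-- The cocycle describing the products of monomials in the `u_i` and `v_i`. -/
def cocycle (m t : ℕ) (q : Fin n → Rˣ) :
    (MWGen.Index m n t → ℤ) →+ (MWGen.Index m n t → ℤ) →+ Additive Rˣ :=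
  AddMonoidHom.mk' (fun α => AddMonoidHom.mk'
    (fun β => ∑ i, (α (.inr (.inl i)) * β (.inr (.inr (.inl i)))) • Additive.ofMul (q i))
    fun β β' => by simp only [Pi.add_apply, mul_add, add_zsmul, Finset.sum_add_distrib])
    fun α α' => AddMonoidHom.ext fun β => by
      simp [add_mul, add_zsmul, Finset.sum_add_distrib]

lemma cocycle_apply (q : Fin n → Rˣ) (α β : MWGen.Index m n t → ℤ) :
    cocycle m t q α β =
      ∑ i, (α (.inr (.inl i)) * β (.inr (.inr (.inl i)))) • Additive.ofMul (q i) := rfl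

/-- The localization of `A_{m,n,t}^{q̄}` at the generators other than the `x_i`. -/
abbrev Model (m t : ℕ) (q : Fin n → Rˣ) : Type _ :=
  CrossedLaurent (weylDegree m n t) (cocycle m t q)

end Model

variable {k : Type u} [Field k] {m n t : ℕ}

/-- The images of the generators in the localization. -/
noncomputable def modelGen (q : Fin n → kˣ) : MWGen m n t → Model m t q
  | .x i => single _ _ (-Pi.single (.inl i) 1) (X i)
  | .y i => single _ _ (Pi.single (.inl i) 1) 1
  | .u i => single _ _ (Pi.single (.inr (.inl i)) 1) 1
  | .v i => single _ _ (Pi.single (.inr (.inr (.inl i))) 1) 1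
  | .z i => single _ _ (Pi.single (.inr (.inr (.inr i))) 1) 1

set_option maxHeartbeats 2000000 in
lemma modelGen_rel (q : Fin n → kˣ) ⦃a b : FreeAlgebra k (MWGen m n t)⦄
    (h : MWRel k m n t (fun i => (q i : k)) a b) :
    FreeAlgebra.lift k (modelGen q) a = FreeAlgebra.lift k (modelGen q) b := by
  induction h with
  | weyl i =>
    simp only [map_mul, map_add, map_one, FreeAlgebra.lift_ι_apply, modelGen]
    rw [single_mul_single, single_mul_single, CrossedLaurent.one_def, neg_add_cancel,
      add_neg_cancel, ← single_add]
    simp [cocycle_apply]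
  | quantum i =>
    simp only [map_mul, AlgHom.commutes, FreeAlgebra.lift_ι_apply, modelGen]
    rw [single_mul_single, single_mul_single, ← Algebra.smul_def, smul_single,
      add_comm (Pi.single (Sum.inr (Sum.inl i)) 1)]
    congr 1
    simp [cocycle_apply, Pi.single_apply]
  | comm a b hab h =>
    simp only [map_mul, FreeAlgebra.lift_ι_apply]
    rcases a with a | a | a | a | a <;> rcases b with b | b | b | b | b <;>
      refine single_mul_single_comm ?_ ?_ <;>
      simp_all [cocycle_apply, Pi.single_apply, MWGen.IsSpecialPair, mul_comm, eq_comm]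

/-- The embedding of `A_{m,n,t}^{q̄}` in its localization. -/
noncomputable def toModel (q : Fin n → kˣ) :
    MixedWeylAlgebra k m n t (fun i => (q i : k)) →ₐ[k] Model m t q :=
  RingQuot.liftAlgHom k ⟨FreeAlgebra.lift k (modelGen q), modelGen_rel q⟩

@[simp] lemma toModel_gen (q : Fin n → kˣ) (g : MWGen m n t) :
    toModel q (gen (fun i => (q i : k)) g) = modelGen q g :=
  (RingQuot.liftAlgHom_mkAlgHom_apply k _ (modelGen_rel q) _).trans (by simp)

lemma toModel_y (q : Fin n → kˣ) (i : MWGen.Index m n t) :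
    toModel q (y (fun i => (q i : k)) i) = single _ _ (Pi.single i 1) 1 := by
  rcases i with i | i | i | i <;> exact toModel_gen q _

lemma toModel_x (q : Fin n → kˣ) (i : Fin m) :
    toModel (t := t) q (x (fun i => (q i : k)) i) =
      single _ _ (-Pi.single (.inl i) 1) (X i) :=
  toModel_gen q _

lemma toModel_injective (q : Fin n → kˣ) : Function.Injective (toModel (m := m) (t := t) q) := by
  refine injective_of_generators (quasiWeylGenerators fun i => (q i).ne_zero) (toModel q)
    (fun i => Pi.single i 1) (fun i => ⟨1, one_ne_zero, by simp [toModel_y]⟩)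
    (fun j => ⟨1, one_ne_zero, by simp [toModel_x]⟩) fun α α' h => ?_
  funext i
  simpa [Finset.sum_apply, Pi.single_apply] using congrFun h i

/-- Monomials with natural exponents belong to the image of `A_{m,n,t}^{q̄}`. -/
lemma single_mem_range (q : Fin n → kˣ) (α : MWGen.Index m n t → ℕ)
    (p : MvPolynomial (Fin m) k) :
    single _ _ (fun i => (α i : ℤ)) p ∈ (toModel (m := m) (t := t) q).range := by
  have hpoly : ∀ p : MvPolynomial (Fin m) k, single _ _ 0 p ∈ (toModel (t := t) q).range := by
    intro p
    induction p using MvPolynomial.induction_on with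
    | C r =>
      have : single _ _ 0 (C r) = algebraMap k (Model m t q) r := by
        rw [Algebra.algebraMap_eq_smul_one, CrossedLaurent.one_def, smul_single, mul_one]
      rw [this]
      exact Subalgebra.algebraMap_mem _ r
    | add p p' hp hp' => rw [single_add]; exact add_mem hp hp'
    | mul_X p i hp =>
      have : single _ _ 0 (p * X i) = single _ _ 0 p *
          toModel (t := t) q (x (fun i => (q i : k)) i * y (fun i => (q i : k)) (.inl i)) := by
        rw [map_mul, toModel_x, toModel_y, single_mul_single, single_mul_single]
        simp [cocycle_apply]
      rw [this]
      exact mul_mem hp ⟨_, rfl⟩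
  have hmonom : ∀ (s : Finset (MWGen.Index m n t)) (α : MWGen.Index m n t → ℕ),
      (∀ i ∉ s, α i = 0) →
      ∀ p, single _ _ (fun i => (α i : ℤ)) p ∈ (toModel (m := m) (t := t) q).range := by
    intro s
    induction s using Finset.induction_on with
    | empty =>
      intro α hα p
      have : (fun i => (α i : ℤ)) = 0 := funext fun i => by simp [hα i]
      rw [this]
      exact hpoly p
    | insert i s hi ih =>
      intro α hα
      have hpow : ∀ (N : ℕ) (β : MWGen.Index m n t → ℤ),
          (∀ p, single _ _ β p ∈ (toModel (m := m) (t := t) q).range) →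
          ∀ p, single _ _ (β + Pi.single i (N : ℤ)) p ∈ (toModel (m := m) (t := t) q).range := by
        intro N
        induction N with
        | zero => intro β hβ p; simpa using hβ p
        | succ N ihN =>
          intro β hβ p
          have h1 := mul_mem (ihN β hβ (C (((cocycle m t q
            (β + Pi.single i (N : ℤ)) (Pi.single i 1)).toMul⁻¹ : kˣ) : k) * p))
            (⟨_, toModel_y q i⟩ : single _ _ (Pi.single i 1) 1 ∈ (toModel q).range)
          rw [single_mul_single, map_one, mul_one, ← mul_assoc, ← C_mul, Units.mul_inv, C_1,
            one_mul, add_assoc, ← Pi.single_add] at h1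
          exact_mod_cast h1
      intro p
      have := hpow (α i) (fun j => ((Function.update α i 0 j : ℕ) : ℤ)) (ih _ fun j hj => ?_) p
      · convert this using 2
        funext j
        by_cases hj : j = i
        · subst hj; simp
        · simp [hj]
      · by_cases hji : j = i
        · subst hji; simp
        · simp [hji, hα j (by simp [hji, hj])]
  exact hmonom Finset.univ α (by simp) p

lemma exists_single_mul_mem_range (q : Fin n → kˣ) (b : Model m t q) :
    ∃ N : ℕ, ∀ M ≥ N, single _ _ (fun _ => (M : ℤ)) 1 * b ∈ (toModel q).range := by
  induction b using CrossedLaurent.induction_on with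
  | zero => exact ⟨0, fun M _ => by rw [mul_zero]; exact zero_mem _⟩
  | add b b' hb hb' =>
    obtain ⟨N, hN⟩ := hb
    obtain ⟨N', hN'⟩ := hb'
    refine ⟨max N N', fun M hM => ?_⟩
    rw [mul_add]
    exact add_mem (hN M (le_of_max_le_left hM)) (hN' M (le_of_max_le_right hM))
  | single α p =>
    refine ⟨∑ i, (α i).natAbs, fun M hM => ?_⟩
    rw [single_mul_single]
    have hα : (fun _ => (M : ℤ)) + α = fun i => (((M + α i).toNat : ℕ) : ℤ) := by
      funext i
      have := Finset.single_le_sum (f := fun i => (α i).natAbs) (fun _ _ => Nat.zero_le _)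
        (Finset.mem_univ i)
      simp only [Pi.add_apply]
      lia
    rw [hα]
    exact single_mem_range q _ _

end MixedWeylAlgebra

section FractionGraph

variable {A D E : Type*} [Ring A] [DivisionRing D] [Ring E]

/-- The graph of the extension to fractions of the correspondence `i a ↦ ρ a`, the denominators
being the elements `b` such that `ρ b` is invertible. -/
def fractionGraph (i : A →+* D) (ρ : A →+* E)
    (ore : ∀ c b, IsUnit (ρ b) → ∃ c' b', IsUnit (ρ b') ∧ c * b' = b * c') : Subring (D × E) where
  carrier := {p | ∃ a b, IsUnit (ρ b) ∧ p.1 * i b = i a ∧ p.2 * ρ b = ρ a}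
  zero_mem' := ⟨0, 1, by simp⟩
  one_mem' := ⟨1, 1, by simp⟩
  neg_mem' := by
    rintro p ⟨a, b, hb, h1, h2⟩
    exact ⟨-a, b, hb, by simp [h1], by simp [h2]⟩
  add_mem' := by
    rintro p p' ⟨a, b, hb, h1, h2⟩ ⟨a', b', hb', h1', h2'⟩
    obtain ⟨c, d, hd, hcd⟩ := ore b b' hb'
    refine ⟨a * d + a' * c, b * d, by rw [map_mul]; exact hb.mul hd, ?_, ?_⟩
    · rw [Prod.fst_add, add_mul, map_add, map_mul i a, ← h1, mul_assoc, ← map_mul, hcd,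
        map_mul i a', ← h1', mul_assoc, ← map_mul]
    · rw [Prod.snd_add, add_mul, map_add, map_mul ρ a, ← h2, mul_assoc, ← map_mul, hcd,
        map_mul ρ a', ← h2', mul_assoc, ← map_mul]
  mul_mem' := by
    rintro p p' ⟨a, b, hb, h1, h2⟩ ⟨a', b', hb', h1', h2'⟩
    obtain ⟨c, d, hd, hcd⟩ := ore a' b hb
    refine ⟨a * c, b' * d, by rw [map_mul]; exact hb'.mul hd, ?_, ?_⟩
    · rw [Prod.fst_mul, map_mul, mul_assoc, ← mul_assoc p'.1, h1', ← map_mul, hcd, map_mul,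
        ← mul_assoc, h1, ← map_mul]
    · rw [Prod.snd_mul, map_mul, mul_assoc, ← mul_assoc p'.2, h2', ← map_mul, hcd, map_mul,
        ← mul_assoc, h2, ← map_mul]

variable {i : A →+* D} {ρ : A →+* E}
  {ore : ∀ c b, IsUnit (ρ b) → ∃ c' b', IsUnit (ρ b') ∧ c * b' = b * c'}

lemma map_mem_fractionGraph (a : A) : (i a, ρ a) ∈ fractionGraph i ρ ore :=
  ⟨a, 1, by simp⟩

lemma exists_mem_fractionGraph [Nontrivial E] (hi : Function.Injective i) {a b : A}
    (hb : IsUnit (ρ b)) :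
    ∃ φ, (i a * (i b)⁻¹, φ) ∈ fractionGraph i ρ ore ∧ φ * ρ b = ρ a := by
  have hb0 : i b ≠ 0 := fun h => hb.ne_zero (by
    rw [(map_eq_zero_iff i hi).1 h, map_zero])
  obtain ⟨v, hv⟩ := hb
  have h2 : ρ a * ↑v⁻¹ * ρ b = ρ a := by rw [← hv, mul_assoc, Units.inv_mul, mul_one]
  exact ⟨ρ a * ↑v⁻¹, ⟨a, b, ⟨v, hv⟩, inv_mul_cancel_right₀ hb0 _, h2⟩, h2⟩

lemma fractionGraph_unique (hi : Function.Injective i) {d : D} {φ φ' : E}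
    (h : (d, φ) ∈ fractionGraph i ρ ore) (h' : (d, φ') ∈ fractionGraph i ρ ore) : φ = φ' := by
  obtain ⟨a, b, hb, h1, h2⟩ := sub_mem h h'
  simp only [Prod.mk_sub_mk, sub_self, zero_mul] at h1 h2
  rw [(map_eq_zero_iff i hi).1 h1.symm, map_zero] at h2
  exact sub_eq_zero.1 (hb.mul_left_eq_zero.1 h2)

end FractionGraph

/-- A homomorphism to a division ring extends to a division ring of fractions. -/
lemma FractionDivisionRing.exists_extension {k : Type u} [Field k] {A : Type u} [Ring A]
    [Algebra k A] (F : FractionDivisionRing k A) {E : Type*} [DivisionRing E] [Algebra k E]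
    (f : A →ₐ[k] E) (hf : Function.Injective f) : Nonempty (F.carrier →ₐ[k] E) := by
  have hunit : ∀ {b : A}, b ≠ 0 → IsUnit ((f : A →+* E) b) := fun hb =>
    ((map_ne_zero_iff f hf).2 hb).isUnit
  have hemb : ∀ {b : A}, b ≠ 0 → F.emb b ≠ 0 := fun hb =>
    (map_ne_zero_iff F.emb F.emb_injective).2 hb
  have ore : ∀ c b, IsUnit ((f : A →+* E) b) →
      ∃ c' b', IsUnit ((f : A →+* E) b') ∧ c * b' = b * c' := by
    intro c b hb
    have hb0 : b ≠ 0 := fun h => hb.ne_zero (by rw [h, map_zero])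
    obtain ⟨c', b', hb', h⟩ := F.frac ((F.emb b)⁻¹ * F.emb c)
    refine ⟨c', b', hunit hb', F.emb_injective ?_⟩
    rw [map_mul, map_mul, ← mul_inv_cancel_left₀ (hemb hb0) (F.emb c), h, mul_assoc,
      inv_mul_cancel_right₀ (hemb hb')]
  have hex : ∀ d : F.carrier, ∃ φ,
      (d, φ) ∈ fractionGraph (F.emb : A →+* F.carrier) (f : A →+* E) ore := by
    intro d
    obtain ⟨a, b, hb, rfl⟩ := F.frac d
    obtain ⟨φ, hφ, -⟩ := exists_mem_fractionGraph (ore := ore)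
      (i := (F.emb : A →+* F.carrier)) F.emb_injective (a := a) (hunit hb)
    exact ⟨φ, hφ⟩
  choose φ hφ using hex
  have huniq : ∀ {d ψ}, (d, ψ) ∈ fractionGraph (F.emb : A →+* F.carrier) (f : A →+* E) ore →
      φ d = ψ :=
    fun h => fractionGraph_unique (i := (F.emb : A →+* F.carrier)) F.emb_injective (hφ _) h
  exact ⟨{
    toFun := φ
    map_one' := huniq (one_mem _)
    map_mul' := fun d d' => huniq (mul_mem (hφ d) (hφ d'))
    map_zero' := huniq (zero_mem _)
    map_add' := fun d d' => huniq (add_mem (hφ d) (hφ d'))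
    commutes' := fun r => huniq (by
      have := map_mem_fractionGraph (i := (F.emb : A →+* F.carrier)) (ρ := (f : A →+* E))
        (ore := ore) (algebraMap k A r)
      simpa using this) }⟩

/-- The division ring of left fractions of a left Ore domain. -/
lemma exists_leftFractions (k : Type*) [Field k] (B : Type u) [Ring B] [Algebra k B]
    [NoZeroDivisors B] [Nontrivial B]
    (ore : ∀ a b : B, b ≠ 0 → ∃ c d : B, d ≠ 0 ∧ d * a = c * b) :
    ∃ (D : Type u) (_ : DivisionRing D) (_ : Algebra k D) (f : B →ₐ[k] D),
      Function.Injective f ∧ ∀ d, ∃ a b, b ≠ 0 ∧ f b * d = f a := by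
  open OreLocalization nonZeroDivisors in
  have : Nonempty (OreSet B⁰) := nonempty_oreSet_iff_of_noZeroDivisors.2 fun a b => by
    obtain ⟨c, d, hd, h⟩ := ore a b (nonZeroDivisors.ne_zero b.2)
    exact ⟨c, ⟨d, mem_nonZeroDivisors_of_ne_zero hd⟩, h⟩
  obtain ⟨_⟩ := this
  refine ⟨OreLocalization (nonZeroDivisors B) B, inferInstance, inferInstance,
    { OreLocalization.numeratorRingHom with commutes' := fun r => rfl },
    OreLocalization.numeratorHom_inj (fun b hb => (mem_nonZeroDivisors_iff.1 hb).1), fun d => ?_⟩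
  induction d using OreLocalization.ind with
  | _ a b =>
    refine ⟨a, b, nonZeroDivisors.ne_zero b.2, ?_⟩
    change (b : B) /ₒ (1 : nonZeroDivisors B) * (a /ₒ b) = a /ₒ 1
    exact OreLocalization.mul_cancel

namespace MixedWeylAlgebra

open MvPolynomial CrossedLaurent

variable {k : Type u} [Field k] {m n t : ℕ}

instance (q : Fin n → kˣ) : NoZeroDivisors (MixedWeylAlgebra k m n t fun i => (q i : k)) :=
  (toModel_injective q).noZeroDivisors _ (map_zero _) (map_mul _)

instance (q : Fin n → kˣ) : Nontrivial (MixedWeylAlgebra k m n t fun i => (q i : k)) :=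
  (toModel q).toRingHom.domain_nontrivial

lemma single_one_ne_zero (q : Fin n → kˣ) (γ : MWGen.Index m n t → ℤ) :
    (single _ _ γ 1 : Model m t q) ≠ 0 := fun h => by
  rw [← single_zero γ] at h
  exact one_ne_zero (single_injective γ h)

lemma exists_common_single_mul_mem_range (q : Fin n → kˣ) (b b' : Model m t q) :
    ∃ γ, single _ _ γ 1 * b ∈ (toModel q).range ∧ single _ _ γ 1 * b' ∈ (toModel q).range := by
  obtain ⟨N, hN⟩ := exists_single_mul_mem_range q b
  obtain ⟨N', hN'⟩ := exists_single_mul_mem_range q b'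
  exact ⟨_, hN _ (le_max_left N N'), hN' _ (le_max_right N N')⟩

lemma model_leftOre (q : Fin n → kˣ) (a b : Model m t q) (hb : b ≠ 0) :
    ∃ c d : Model m t q, d ≠ 0 ∧ d * a = c * b := by
  obtain ⟨γ, ⟨a', ha⟩, b', hb'⟩ := exists_common_single_mul_mem_range q a b
  have hb0 : b' ≠ 0 := by
    rintro rfl
    exact mul_ne_zero (single_one_ne_zero q γ) hb (hb'.symm.trans (map_zero _))
  obtain ⟨c, d, hd, h⟩ := (quasiWeylGenerators fun i => (q i).ne_zero).exists_left_ore a' b' hb0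
  refine ⟨toModel q c * single _ _ γ 1, toModel q d * single _ _ γ 1,
    mul_ne_zero ((map_ne_zero_iff _ (toModel_injective q)).2 hd) (single_one_ne_zero q γ), ?_⟩
  have h' := congrArg (toModel q) h
  rw [map_mul, map_mul] at h'
  rw [mul_assoc, mul_assoc]
  exact (congrArg _ ha.symm).trans (h'.trans (congrArg _ hb'))

lemma exists_fractionDivisionRing (q : Fin n → kˣ) :
    ∃ (D : FractionDivisionRing k (MixedWeylAlgebra k m n t fun i => (q i : k)))
      (f : Model m t q →ₐ[k] D.carrier), Function.Injective f ∧ ∀ a, f (toModel q a) = D.emb a := by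
  obtain ⟨D, _, _, f, hf, hfrac⟩ := exists_leftFractions k (Model m t q) (model_leftOre q)
  have hinj : Function.Injective (f.comp (toModel q)) := hf.comp (toModel_injective q)
  refine ⟨⟨D, f.comp (toModel q), hinj, fun d => ?_⟩, f, hf, fun _ => rfl⟩
  obtain ⟨a, b, hb, hd⟩ := hfrac d
  obtain ⟨γ, ⟨a', ha⟩, b', hb'⟩ := exists_common_single_mul_mem_range q a b
  have hb0 : b' ≠ 0 := by
    rintro rfl
    exact mul_ne_zero (single_one_ne_zero q γ) hb (hb'.symm.trans (map_zero _))
  obtain ⟨c, e, he, h⟩ := (quasiWeylGenerators fun i => (q i).ne_zero).exists_right_ore a' b' hb0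
  refine ⟨c, e, he, ?_⟩
  have ha' : f (toModel q a') = f (single _ _ γ 1) * f a := by rw [← map_mul]; exact congrArg f ha
  have hb'' : f (toModel q b') = f (single _ _ γ 1) * f b := by
    rw [← map_mul]; exact congrArg f hb'
  have h0 : ∀ {b}, b ≠ 0 → f.comp (toModel q) b ≠ 0 := fun hb => (map_ne_zero_iff _ hinj).2 hb
  rw [eq_mul_inv_iff_mul_eq₀ (h0 he)]
  refine mul_left_cancel₀ (h0 hb0) ?_
  rw [← map_mul, ← h, map_mul, ← mul_assoc]
  congr 1
  simp only [AlgHom.comp_apply, ha', hb'', mul_assoc, hd]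

end MixedWeylAlgebra

namespace MixedCrossedAlgebra

open MvPolynomial CrossedLaurent MixedWeylAlgebra

variable {k : Type u} [Field k] {n : ℕ} {Λ : Matrix (Fin n) (Fin n) k} {r : ℕ}

lemma exists_toModel (hr : r ≤ n) (hΛ : Λ.MulAntisymmetric) (q : Fin (n * n) → kˣ)
    (hq : ∀ p, Λ (finProdFinEquiv.symm p).1 (finProdFinEquiv.symm p).2 ≠ 1 →
      (q p : k) = Λ (finProdFinEquiv.symm p).1 (finProdFinEquiv.symm p).2) :
    ∃ f : MixedCrossedAlgebra k Λ r hr →ₐ[k] Model r n q, Function.Injective f := by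
  classical
  let θ : Fin n → MWGen.Index r (n * n) n → ℤ := fun i => Sum.elim
    (fun a => if Fin.castLE hr a = i then 1 else 0) (Sum.elim
    (fun p => if (finProdFinEquiv.symm p).1 = i ∧ i < (finProdFinEquiv.symm p).2 ∧
      Λ (finProdFinEquiv.symm p).1 (finProdFinEquiv.symm p).2 ≠ 1 then 1 else 0) (Sum.elim
    (fun p => if (finProdFinEquiv.symm p).2 = i then 1 else 0)
    (fun a => if a = i then 1 else 0)))
  have hc : ∀ i j, (((cocycle r n q (θ i) (θ j)).toMul : kˣ) : k) =
      if i < j then Λ i j else 1 := by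
    intro i j
    rw [cocycle_apply, Finset.sum_eq_single (finProdFinEquiv (i, j))]
    · simp only [θ, Sum.elim_inl, Sum.elim_inr, Equiv.symm_apply_apply]
      have := hq (finProdFinEquiv (i, j))
      simp only [Equiv.symm_apply_apply] at this
      by_cases hij : i < j <;> by_cases h1 : Λ i j = 1 <;> simp [hij, h1, this]
    · intro p _ hp
      have : ¬ ((finProdFinEquiv.symm p).1 = i ∧ (finProdFinEquiv.symm p).2 = j) := by
        rintro ⟨h1, h2⟩
        exact hp ((Equiv.symm_apply_eq _).1 (Prod.ext h1 h2))
      simp only [θ, Sum.elim_inl, Sum.elim_inr]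
      by_cases h1 : (finProdFinEquiv.symm p).1 = i <;>
        by_cases h2 : (finProdFinEquiv.symm p).2 = j <;> simp_all
    · simp
  have hcc : ∀ i j, (((cocycle r n q (θ i) (θ j)).toMul : kˣ) : k) =
      Λ i j * ((cocycle r n q (θ j) (θ i)).toMul : kˣ) := by
    intro i j
    rw [hc, hc]
    rcases lt_trichotomy i j with h | h | h
    · simp [h, h.not_gt]
    · simp [h, hΛ.1]
    · simp [h, h.not_gt, hΛ.2]
  have hne : ∀ i j, Λ i j ≠ 0 := fun i j => left_ne_zero_of_mul_eq_one (hΛ.2 i j)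
  have hδ : ∀ (a : Fin r) i, θ i (.inl a) = if Fin.castLE hr a = i then 1 else 0 :=
    fun _ _ => rfl
  obtain ⟨f, hfy, hfx⟩ := exists_lift (hr := hr) (Λ := Λ)
    (fun i => (single _ _ (θ i) 1 : Model r n q))
    (fun i => single _ _ (-θ (Fin.castLE hr i)) (X i))
    (fun i j => by
      rw [single_mul_single, single_mul_single, smul_single, hcc, add_comm, C_mul]
      simp)
    (fun i => by
      rw [single_mul_single, single_mul_single, CrossedLaurent.one_def, neg_add_cancel,
        add_neg_cancel, ← single_add]
      congr 1
      simp [hδ, hc])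
    (fun i j hij => by
      rw [single_mul_single, single_mul_single, smul_single, add_comm]
      congr 1
      have := hcc (Fin.castLE hr i) j
      simp only [map_neg, AddMonoidHom.neg_apply, toMul_neg, Units.val_inv_eq_inv_val, this,
        map_one, mul_one, one_mul, shift_X, weylDegree_apply, hδ, if_neg hij, Int.cast_zero, C_0,
        sub_zero]
      rw [← mul_assoc, ← C_mul, mul_inv])
    (fun i j => by
      rw [single_mul_single, single_mul_single, smul_single, add_comm]
      congr 1
      simp only [map_neg, AddMonoidHom.neg_apply, neg_neg]
      rw [hcc, C_mul, mul_assoc]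
      by_cases hij : i = j
      · simp [hij]
      · have hij' : Fin.castLE hr i ≠ Fin.castLE hr j := fun h =>
          hij (Fin.castLE_injective hr h)
        simp [hδ, hij', hij'.symm, mul_comm (X i)])
  refine ⟨f, injective_of_generators (quasiWeylGenerators hΛ) f θ
    (fun i => ⟨1, one_ne_zero, by rw [hfy, C_1]⟩)
    (fun i => ⟨1, one_ne_zero, by rw [hfx, C_1, one_mul]⟩) fun α α' h => ?_⟩
  funext i
  simpa [Finset.sum_apply, θ] using congrFun h (.inr (.inr (.inr i)))

lemma exists_embedding [CharZero k] (hr : r ≤ n) (hΛ : Λ.MulAntisymmetric)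
    (F : FractionDivisionRing k (MixedCrossedAlgebra k Λ r hr)) :
    ∃ (s t : ℕ) (q : Fin s → k), (∀ i, q i ≠ 0 ∧ q i ≠ 1) ∧
      ∃ (D' : FractionDivisionRing k (MixedWeylAlgebra k r s t q))
        (g : F.carrier →ₐ[k] D'.carrier), Function.Injective g := by
  classical
  have hne : ∀ i j, Λ i j ≠ 0 := fun i j => left_ne_zero_of_mul_eq_one (hΛ.2 i j)
  let q : Fin (n * n) → kˣ := fun p =>
    if Λ (finProdFinEquiv.symm p).1 (finProdFinEquiv.symm p).2 = 1 then Units.mk0 2 two_ne_zero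
    else Units.mk0 _ (hne (finProdFinEquiv.symm p).1 (finProdFinEquiv.symm p).2)
  obtain ⟨f, hf⟩ := exists_toModel hr hΛ q fun p hp => by rw [show q p = _ from if_neg hp]; rfl
  obtain ⟨D', φ, hφ, -⟩ := exists_fractionDivisionRing (m := r) (t := n) q
  obtain ⟨g⟩ := F.exists_extension (φ.comp f) (hφ.comp hf)
  refine ⟨n * n, n, fun i => q i, fun p => ⟨(q p).ne_zero, ?_⟩, D', g, g.toRingHom.injective⟩
  change (q p : k) ≠ 1
  by_cases hp : Λ (finProdFinEquiv.symm p).1 (finProdFinEquiv.symm p).2 = 1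
  · rw [show q p = _ from if_pos hp, Units.val_mk0]
    exact OfNat.ofNat_ne_one 2
  · rwa [show q p = _ from if_neg hp, Units.val_mk0]

end MixedCrossedAlgebra

lemma Int.isJacobsonRing : IsJacobsonRing ℤ := by
  refine isJacobsonRing_iff_prime_eq.2 fun P hP => ?_
  by_cases h : P = ⊥
  · subst h
    refine eq_bot_iff.2 fun x hx => ?_
    have := Ideal.mem_jacobson_bot.1 hx x
    rw [Int.isUnit_iff] at this
    rw [Ideal.mem_bot]
    rcases this with h | h
    · exact mul_self_eq_zero.1 (by linarith)
    · nlinarith [mul_self_nonneg x]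
  · have := hP.isMaximal h
    exact Ideal.jacobson_eq_self_of_isMaximal

/-- A field that is finitely generated as an abelian group is finite. -/
lemma exists_prime_charP_of_finite_int (K : Type*) [Field K] [Module.Finite ℤ K] :
    ∃ p : ℕ, p.Prime ∧ CharP K p ∧ Finite K := by
  obtain ⟨p, hp⟩ := CharP.exists K
  have hp0 : p ≠ 0 := by
    rintro rfl
    have : CharZero K := CharP.charP_to_charZero _
    have hint : Algebra.IsIntegral ℤ K := Algebra.IsIntegral.of_finite ℤ _
    exact Int.not_isField ((Algebra.IsIntegral.isField_iff_isField
      (algebraMap ℤ K).injective_int).2 (Field.toIsField _))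
  refine ⟨p, (CharP.char_is_prime_or_zero K p).resolve_right hp0, hp, ?_⟩
  have : NeZero p := ⟨hp0⟩
  let _ : Algebra (ZMod p) K := ZMod.algebra _ p
  have : Module.Finite (ZMod p) K := Module.Finite.of_restrictScalars_finite ℤ _ _
  exact Module.finite_of_finite (ZMod p)

/-- Finitely many nonzero elements of a field are units for some valuation ring whose residue field
has positive characteristic, with residues of finite order. -/
lemma exists_valuationSubring_residue_pow_eq_one {k : Type*} [Field k] (U : Finset kˣ) :
    ∃ (V : ValuationSubring k) (p N : ℕ), p.Prime ∧
      CharP (IsLocalRing.ResidueField V) p ∧ 0 < N ∧ p.Coprime N ∧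
      ∀ u ∈ U, ∃ v : Vˣ, ((v : V) : k) = u ∧ IsLocalRing.residue V v ^ N = 1 := by
  classical
  have := Int.isJacobsonRing
  let S : Finset k := U.image (fun u : kˣ => (u : k)) ∪ U.image (fun u : kˣ => ((u⁻¹ : kˣ) : k))
  let R : Subalgebra ℤ k := Algebra.adjoin ℤ (S : Set k)
  have hR : Algebra.FiniteType ℤ R := (Subalgebra.fg_iff_finiteType R).1 ⟨S, rfl⟩
  obtain ⟨M, hM⟩ := Ideal.exists_maximal R
  let _ : Field (R ⧸ M) := Ideal.Quotient.field M
  have : Algebra.FiniteType ℤ (R ⧸ M) := Algebra.FiniteType.of_surjective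
    (Ideal.Quotient.mkₐ ℤ M) Ideal.Quotient.mk_surjective
  have hfin : Module.Finite ℤ (R ⧸ M) := finite_of_finite_type_of_isJacobsonRing ℤ (R ⧸ M)
  obtain ⟨p, hpp, hp, _⟩ := exists_prime_charP_of_finite_int (R ⧸ M)
  obtain ⟨V, hRV, hV⟩ := Ideal.image_subset_nonunits_valuationSubring (A := R.toSubring) M hM.ne_top
  have hmem : ∀ x : R, x ∈ M → ∃ h : (x : k) ∈ V, IsLocalRing.residue V ⟨x, h⟩ = 0 := by
    intro x hx
    have h1 : (x : k) ∈ (V.nonunits : Set k) := hV ⟨x, hx, rfl⟩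
    refine ⟨hRV x.2, ?_⟩
    rw [IsLocalRing.residue_eq_zero_iff]
    rw [← V.image_maximalIdeal] at h1
    obtain ⟨y, hy, hyx⟩ := h1
    rwa [← show y = ⟨x, hRV x.2⟩ from Subtype.ext hyx]
  cases nonempty_fintype (R ⧸ M)
  refine ⟨V, p, Fintype.card (R ⧸ M) - 1, hpp, ?_, ?_, ?_, fun u hu => ?_⟩
  · have hpM : (p : R) ∈ M := by
      rw [← Ideal.Quotient.eq_zero_iff_mem, map_natCast, CharP.cast_eq_zero]
    obtain ⟨h1, h2⟩ := hmem _ hpM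
    have h3 : (p : IsLocalRing.ResidueField V) = 0 := by
      rw [← map_natCast (IsLocalRing.residue V), ← h2]
      congr 1
    exact (CharP.charP_iff_prime_eq_zero hpp).2 h3
  · have := Fintype.one_lt_card (α := R ⧸ M)
    lia
  · have h1 : p ∣ Fintype.card (R ⧸ M) := by
      rw [← CharP.cast_eq_zero_iff (R ⧸ M) p, Nat.cast_card_eq_zero]
    refine (Nat.Prime.coprime_iff_not_dvd hpp).2 fun h2 => hpp.one_lt.ne' ?_
    have := Fintype.card_pos (α := R ⧸ M)
    exact Nat.dvd_one.1 (by simpa [Nat.sub_sub_self this] using Nat.dvd_sub h1 h2)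
  · have hu1 : (u : k) ∈ R := Algebra.subset_adjoin (by
      simp only [S, Finset.coe_union, Finset.coe_image]
      exact Or.inl ⟨u, hu, rfl⟩)
    have hu2 : ((u⁻¹ : kˣ) : k) ∈ R := Algebra.subset_adjoin (by
      simp only [S, Finset.coe_union, Finset.coe_image]
      exact Or.inr ⟨u, hu, rfl⟩)
    refine ⟨⟨⟨u, hRV hu1⟩, ⟨_, hRV hu2⟩, by ext; simp, by ext; simp⟩, rfl, ?_⟩
    have hunit : IsUnit (⟨u, hu1⟩ : R) := IsUnit.of_mul_eq_one ⟨_, hu2⟩ (by ext; simp)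
    have hmk : Ideal.Quotient.mk M ⟨u, hu1⟩ ≠ 0 := (hunit.map (Ideal.Quotient.mk M)).ne_zero
    have hpow := FiniteField.pow_card_sub_one_eq_one _ hmk
    rw [← map_pow, ← map_one (Ideal.Quotient.mk M), Ideal.Quotient.mk_eq_mk_iff_sub_mem] at hpow
    obtain ⟨h1, h2⟩ := hmem _ hpow
    rw [← sub_eq_zero, ← map_one (IsLocalRing.residue V), ← map_pow, ← map_sub, ← h2]
    rfl

namespace CrossedLaurent

open MvPolynomial

section Map

variable {R S Γ J : Type*} [CommRing R] [CommRing S] [AddCommGroup Γ] {δ : J → Γ →+ ℤ}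
  {c : Γ →+ Γ →+ Additive Rˣ} {c' : Γ →+ Γ →+ Additive Sˣ}

/-- Change of coefficients. -/
noncomputable def map (φ : R →+* S) (hc : ∀ a b, ((c' a b).toMul : S) = φ (c a b).toMul) :
    CrossedLaurent δ c →+* CrossedLaurent δ c' :=
  let f : CrossedLaurent δ c →+ CrossedLaurent δ c' := lift fun a =>
    AddMonoidHom.mk' (fun p => single δ c' a (MvPolynomial.map φ p))
      (fun p q => by rw [map_add, single_add])
  { f with
    map_one' := by simp [f, one_def]
    map_mul' := fun b b' => by
      change f (b * b') = f b * f b'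
      induction b using CrossedLaurent.induction_on with
      | zero => simp
      | add x x' hx hx' => simp only [add_mul, map_add, hx, hx']
      | single a p =>
      induction b' using CrossedLaurent.induction_on with
      | zero => simp
      | add y y' hy hy' => simp only [mul_add, map_add, hy, hy']
      | single b q => simp [f, single_mul_single, hc, map_shift] }

lemma coeff_map (φ : R →+* S) (hc : ∀ a b, ((c' a b).toMul : S) = φ (c a b).toMul)
    (b : CrossedLaurent δ c) (a : Γ) :
    (map φ hc b).coeff a = MvPolynomial.map φ (b.coeff a) := by
  classical
  induction b using CrossedLaurent.induction_on with
  | zero => simp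
  | add x x' hx hx' => simp only [map_add, coeff_add, hx, hx']
  | single a' p =>
    change (lift _ (single δ c a' p) : CrossedLaurent δ c').coeff a = _
    rw [lift_single]
    simp only [AddMonoidHom.mk'_apply, coeff_single]
    split_ifs <;> simp

end Map

section Matrix

variable {K Γ J H : Type*} [CommRing K] [AddCommGroup Γ] [AddCommGroup H]
  {δ : J → Γ →+ ℤ} {c : Γ →+ Γ →+ Additive Kˣ}

/-- The translation `w_j ↦ w_j - d_j(h)`. -/
noncomputable def translate (d : J → H →+ K) (h : H) : MvPolynomial J K →ₐ[K] MvPolynomial J K :=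
  aeval fun j => X j - C (d j h)

@[simp] lemma translate_X (d : J → H →+ K) (h : H) (j : J) :
    translate d h (X j) = X j - C (d j h) := by
  simp [translate]

@[simp] lemma translate_C (d : J → H →+ K) (h : H) (r : K) : translate d h (C r) = C r := by
  simp [translate]

lemma translate_injective (d : J → H →+ K) (h : H) : Function.Injective (translate d h) := by
  have : (translate d (-h)).comp (translate d h) = AlgHom.id K _ := by
    ext j : 1
    simp
  exact Function.LeftInverse.injective (g := translate d (-h)) fun p => DFunLike.congr_fun this p

variable [Fintype H] [DecidableEq H]

/-- When `δ` and `c` factor modulo the kernel of a homomorphism `π` to a finite group, the twisted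
Laurent polynomial ring is represented by matrices over a commutative ring. -/
noncomputable def toMatrix (π : Γ →+ H) (d : J → H →+ K) (hd : ∀ j a, d j (π a) = (δ j a : K))
    (χ : H →+ Γ →+ Additive Kˣ) (hχ : ∀ a, χ (π a) = c a) :
    CrossedLaurent δ c →+* Matrix H H (AddMonoidAlgebra (MvPolynomial J K) Γ) :=
  let f : CrossedLaurent δ c →+ Matrix H H (AddMonoidAlgebra (MvPolynomial J K) Γ) := lift fun a =>
    AddMonoidHom.mk' (fun p => Matrix.of fun h h' => if h' = h + π a then
      AddMonoidAlgebra.single a (C ((χ h a).toMul : K) * translate d h p) else 0)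
      (fun p q => by
        ext h h' : 2
        simp only [Matrix.of_apply, Matrix.add_apply]
        split_ifs
        · rw [map_add, mul_add, AddMonoidAlgebra.single_add]
        · rw [add_zero])
  { f with
    map_one' := by
      change f 1 = 1
      refine Matrix.ext fun h h' => ?_
      simp only [f, one_def, lift_single, AddMonoidHom.mk'_apply, Matrix.of_apply, map_zero,
        add_zero, toMul_zero, Units.val_one, map_one, one_mul, Matrix.one_apply, eq_comm]
      rfl
    map_mul' := fun b b' => by
      change f (b * b') = f b * f b'
      induction b using CrossedLaurent.induction_on with
      | zero => simp
      | add x x' hx hx' => simp only [add_mul, map_add, hx, hx']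
      | single a p =>
      induction b' using CrossedLaurent.induction_on with
      | zero => simp
      | add y y' hy hy' => simp only [mul_add, map_add, hy, hy']
      | single b q =>
        refine Matrix.ext fun h h' => ?_
        have hcomp : translate d h (shift δ K a q) = translate d (h + π a) q := by
          have : (translate d h).comp (shift δ K a) = translate d (h + π a) := by
            ext j : 1
            simp [hd, sub_sub]
          rw [← this, AlgHom.comp_apply]
        simp only [f, single_mul_single, lift_single, AddMonoidHom.mk'_apply, Matrix.of_apply,
          Matrix.mul_apply]
        rw [Finset.sum_eq_single (h + π a) (fun j _ hj => by rw [if_neg hj, zero_mul]) (by simp),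
          if_pos rfl, map_add, ← add_assoc, mul_ite, mul_zero]
        split_ifs
        · rw [AddMonoidAlgebra.single_mul_single]
          congr 1
          simp only [map_mul, translate_C, hcomp, map_add, AddMonoidHom.add_apply, hχ, toMul_add,
            Units.val_mul]
          ring
        · rfl }

variable {π : Γ →+ H} {d : J → H →+ K} {hd : ∀ j a, d j (π a) = (δ j a : K)}
    {χ : H →+ Γ →+ Additive Kˣ} {hχ : ∀ a, χ (π a) = c a}

lemma coeff_toMatrix (b : CrossedLaurent δ c) (h h' : H) (a : Γ) :
    (toMatrix π d hd χ hχ b h h').coeff a =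
      if h' = h + π a then C ((χ h a).toMul : K) * translate d h (b.coeff a) else 0 := by
  classical
  induction b using CrossedLaurent.induction_on with
  | zero => simp
  | add x x' hx hx' =>
    simp only [map_add, coeff_add, Matrix.add_apply, AddMonoidAlgebra.coeff_add,
      Finsupp.add_apply, hx, hx', mul_add]
    split_ifs <;> simp
  | single a' p =>
    change ((lift _ (single δ c a' p) : Matrix H H (AddMonoidAlgebra (MvPolynomial J K) Γ))
      h h').coeff a = _
    rw [lift_single]
    simp only [AddMonoidHom.mk'_apply, coeff_single, Matrix.of_apply]
    by_cases ha : a' = a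
    · subst ha
      simp only [if_true]
      split_ifs <;> simp
    · rw [if_neg ha]
      split_ifs <;> simp [ha]

lemma det_toMatrix_ne_zero [IsDomain K] [UniqueSums Γ] {b : CrossedLaurent δ c} (hb : b ≠ 0) :
    (toMatrix π d hd χ hχ b).det ≠ 0 := by
  classical
  rw [Ne, ← Matrix.exists_mulVec_eq_zero_iff]
  rintro ⟨v, hv, hbv⟩
  obtain ⟨h₀, hh₀⟩ := Function.ne_iff.1 hv
  have hS : (Finset.univ.biUnion fun h => (v h).coeff.support).Nonempty := by
    obtain ⟨a, ha⟩ := Finsupp.support_nonempty_iff.2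
      (fun h => hh₀ (AddMonoidAlgebra.coeff_injective h) : (v h₀).coeff ≠ 0)
    exact ⟨a, Finset.mem_biUnion.2 ⟨h₀, Finset.mem_univ _, ha⟩⟩
  have hb' : b.support.Nonempty := by
    rw [Finset.nonempty_iff_ne_empty]
    intro he
    exact hb (by rw [← sum_single b, he, Finset.sum_empty])
  obtain ⟨a, ha, a', ha', hu⟩ := UniqueSums.uniqueAdd_of_nonempty hb' hS
  obtain ⟨h, -, hh⟩ := Finset.mem_biUnion.1 ha'
  have hsum : ∀ h'', (toMatrix π d hd χ hχ b (h - π a) h'' * v h'').coeff (a + a') =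
      if h'' = h then C ((χ (h - π a) a).toMul : K) * translate d (h - π a) (b.coeff a) *
        (v h'').coeff a' else 0 := by
    intro h''
    rw [AddMonoidAlgebra.coeff_mul_add_of_uniqueAdd (hu.mono (fun x hx => ?_) (fun x hx => ?_)),
      coeff_toMatrix, sub_add_cancel]
    · split_ifs <;> simp
    · rw [Finsupp.mem_support_iff, coeff_toMatrix] at hx
      rw [mem_support]
      intro h0
      simp [h0] at hx
    · exact Finset.mem_biUnion.2 ⟨h'', Finset.mem_univ _, hx⟩
  have key := congrArg (fun w => (w (h - π a)).coeff (a + a')) hbv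
  simp only [Matrix.mulVec, dotProduct, AddMonoidAlgebra.coeff_sum, Finsupp.finsetSum_apply, hsum,
    Finset.sum_ite_eq', Finset.mem_univ, if_true, Pi.zero_apply, AddMonoidAlgebra.coeff_zero,
    Finsupp.zero_apply, mul_eq_zero, C_eq_zero, Units.ne_zero, false_or] at key
  rcases key with key | key
  · exact mem_support.1 ha (translate_injective d _ (by rw [key, map_zero]))
  · exact Finsupp.mem_support_iff.1 hh key

end Matrix

end CrossedLaurent

/-- The sum of a function which is invariant under the translations by a finite subgroup is
divisible by the order of this subgroup. -/
lemma card_dvd_sum_of_translation_invariant {G A : Type*} [AddCommGroup G] [Fintype G]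
    [AddCommGroup A] {φ : G →+ A} (hφ : Function.Injective φ) {T : Finset A} {N : A → ℕ}
    (hN : ∀ g a, N (a + φ g) = N a) (hT : ∀ a, a ∈ T ↔ N a ≠ 0) :
    Fintype.card G ∣ ∑ a ∈ T, N a := by
  classical
  rw [← Finset.sum_fiberwise_of_maps_to (g := (QuotientAddGroup.mk : A → A ⧸ φ.range))
    (t := T.image QuotientAddGroup.mk) fun a ha => Finset.mem_image_of_mem _ ha]
  refine Finset.dvd_sum fun b hb => ?_
  obtain ⟨a, ha, rfl⟩ := Finset.mem_image.1 hb
  have hfiber : {x ∈ T | (QuotientAddGroup.mk x : A ⧸ φ.range) = QuotientAddGroup.mk a} =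
      Finset.univ.image fun g => a + φ g := by
    ext x
    simp only [Finset.mem_filter, Finset.mem_image, Finset.mem_univ, true_and]
    constructor
    · rintro ⟨-, hx⟩
      obtain ⟨g, hg⟩ := QuotientAddGroup.eq.1 hx.symm
      exact ⟨g, by rw [hg]; abel⟩
    · rintro ⟨g, rfl⟩
      refine ⟨(hT _).2 (by rw [hN]; exact (hT _).1 ha), Eq.symm ?_⟩
      exact QuotientAddGroup.eq.2 ⟨g, by abel⟩
  rw [hfiber, Finset.sum_image fun g _ g' _ h => hφ (add_left_cancel h)]
  simp [hN]

/-- A representation of the localized Weyl algebra over a field of characteristic `p` has dimension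
divisible by `p ^ r`. -/
lemma pow_dvd_finrank_of_weyl {L V : Type*} [Field L] [IsAlgClosed L] [AddCommGroup V] [Module L V]
    [FiniteDimensional L V] {p : ℕ} (hp : p.Prime) [CharP L p] {r : ℕ}
    (X W : Fin r → Module.End L V) (hX : ∀ i, IsUnit (X i)) (hW : ∀ i j, Commute (W i) (W j))
    (hXW : ∀ i j, X i * W j = (W j + if i = j then 1 else 0) * X i) :
    p ^ r ∣ Module.finrank L V := by
  classical
  have : NeZero p := ⟨hp.ne_zero⟩
  let E : (Fin r → L) → Submodule L V := fun χ => ⨅ i, (W i).maxGenEigenspace (χ i)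
  have hE : ∀ χ v, v ∈ E χ ↔ ∀ i, ∃ k : ℕ, ((W i - χ i • (1 : Module.End L V)) ^ k) v = 0 := by
    simp [E]
  have hshift : ∀ j χ, Module.finrank L (E (χ + Pi.single j 1)) = Module.finrank L (E χ) := by
    intro j χ
    let e : V ≃ₗ[L] V := LinearEquiv.ofBijective (X j) ((Module.End.isUnit_iff _).1 (hX j))
    have hcomap : (E χ).comap (e : V →ₗ[L] V) = E (χ + Pi.single j 1) := by
      ext v
      rw [Submodule.mem_comap, hE, hE]
      refine forall_congr' fun i => exists_congr fun k => ?_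
      have hsemi : SemiconjBy (X j) (W i - (χ + Pi.single j 1 : Fin r → L) i • (1 : Module.End L V))
          (W i - χ i • (1 : Module.End L V)) := by
        rw [SemiconjBy, mul_sub, hXW]
        by_cases h : j = i
        · subst h
          simp [add_smul, add_mul, sub_mul, mul_add]
        · simp [h, Ne.symm h, sub_mul]
      have := DFunLike.congr_fun (hsemi.pow_right k) v
      rw [Module.End.mul_apply, Module.End.mul_apply] at this
      change ((W i - χ i • (1 : Module.End L V)) ^ k) (X j v) = 0 ↔ _
      rw [← this]
      exact map_eq_zero_iff e e.injective
    rw [← hcomap, ← LinearEquiv.finrank_map_eq e, Submodule.map_comap_eq_of_surjective e.surjective]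
  have hindep : iSupIndep E := Module.End.independent_iInf_maxGenEigenspace_of_forall_mapsTo W
    fun i j φ => Module.End.mapsTo_maxGenEigenspace_of_comm (hW j i) φ
  have htop : ⨆ χ, E χ = ⊤ :=
    Module.End.iSup_iInf_maxGenEigenspace_eq_top_of_iSup_maxGenEigenspace_eq_top_of_commute W
      (fun i j _ => hW i j) fun i => Module.End.iSup_maxGenEigenspace_eq_top _
  have hint : DirectSum.IsInternal E :=
    DirectSum.isInternal_submodule_of_iSupIndep_of_iSup_eq_top hindep htop
  have hfin : {χ | E χ ≠ ⊥}.Finite := WellFoundedGT.finite_ne_bot_of_iSupIndep hindep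
  let _ : Fintype {χ // E χ ≠ ⊥} := hfin.fintype
  let _ : Fintype {χ | E χ ≠ ⊥} := hfin.fintype
  have hsum : Module.finrank L V = ∑ χ ∈ hfin.toFinset, Module.finrank L (E χ) := by
    have := (LinearEquiv.ofBijective (DirectSum.coeLinearMap fun χ : {χ // E χ ≠ ⊥} => E χ)
      (DirectSum.isInternal_ne_bot_iff.2 hint)).finrank_eq
    rw [← this, Module.finrank_directSum, ← Finset.sum_coe_sort hfin.toFinset]
    exact Equiv.sum_comp hfin.subtypeEquivToFinset fun χ => Module.finrank L (E χ)
  let φ : (Fin r → ZMod p) →+ (Fin r → L) :=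
    AddMonoidHom.mk' (fun g j => ZMod.castHom dvd_rfl L (g j)) fun g g' => by
      funext j
      simp
  have hφ : Function.Injective φ := fun g g' h => funext fun j =>
    ZMod.castHom_injective L (congrFun h j)
  have hinv : ∀ g χ, Module.finrank L (E (χ + φ g)) = Module.finrank L (E χ) := by
    let S : AddSubmonoid (Fin r → L) :=
      { carrier := {b | ∀ χ, Module.finrank L (E (χ + b)) = Module.finrank L (E χ)}
        zero_mem' := fun χ => by rw [add_zero]
        add_mem' := fun {b b'} hb hb' χ => by rw [← add_assoc, hb', hb] }
    intro g
    suffices φ g ∈ S from this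
    have : φ g = ∑ j, (g j).val • Pi.single j (1 : L) := by
      funext j
      simp only [Finset.sum_apply, Pi.smul_apply, Pi.single_apply]
      simp [φ]
    rw [this]
    exact sum_mem fun j _ => nsmul_mem (show Pi.single j 1 ∈ S from hshift j) _
  have := card_dvd_sum_of_translation_invariant hφ (T := hfin.toFinset) hinv fun χ => by
    rw [Set.Finite.mem_toFinset]
    exact not_congr Submodule.finrank_eq_zero.symm
  rw [hsum]
  simpa [ZMod.card] using this

namespace CrossedLaurent

open MvPolynomial

section Coeffs

variable {R S Γ J : Type*} [CommRing R] [CommRing S] [AddCommGroup Γ] {δ : J → Γ →+ ℤ}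
  {c : Γ →+ Γ →+ Additive Rˣ} {c' : Γ →+ Γ →+ Additive Sˣ}

/-- The set of all nonzero scalars which appear in an element. -/
noncomputable def coeffs (b : CrossedLaurent δ c) : Finset R :=
  open Classical in b.support.biUnion fun a => (b.coeff a).coeffs

lemma mem_coeffs {b : CrossedLaurent δ c} {x : R} :
    x ∈ b.coeffs ↔ x ≠ 0 ∧ ∃ a s, (b.coeff a).coeff s = x := by
  simp only [coeffs, Finset.mem_biUnion, mem_support]
  constructor
  · rintro ⟨a, -, ha⟩
    obtain ⟨s, -, rfl⟩ := mem_coeffs_iff.1 ha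
    exact ⟨fun h => zero_notMem_coeffs _ (h ▸ ha), a, s, rfl⟩
  · rintro ⟨h, a, s, rfl⟩
    exact ⟨a, fun ha => h (by rw [ha, MvPolynomial.coeff_zero]), coeff_mem_coeffs s h⟩

lemma ne_zero_of_mem_coeffs {b : CrossedLaurent δ c} {x : R} (hx : x ∈ b.coeffs) : x ≠ 0 :=
  (mem_coeffs.1 hx).1

lemma coeffs_nonempty {b : CrossedLaurent δ c} (hb : b ≠ 0) : b.coeffs.Nonempty := by
  by_contra! h
  refine hb (CrossedLaurent.ext fun a => MvPolynomial.ext _ _ fun s => ?_)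
  by_contra! h0
  simpa [h] using mem_coeffs.2 ⟨h0, a, s, rfl⟩

lemma exists_of_mem_coeffs_smul {b : CrossedLaurent δ c} {r x : R} (hx : x ∈ (r • b).coeffs) :
    ∃ y ∈ b.coeffs, r * y = x := by
  obtain ⟨h, a, s, rfl⟩ := mem_coeffs.1 hx
  rw [coeff_smul, MvPolynomial.coeff_smul, smul_eq_mul] at h ⊢
  exact ⟨_, mem_coeffs.2 ⟨right_ne_zero_of_mul h, a, s, rfl⟩, rfl⟩

variable {φ : R →+* S} {hc : ∀ a b, ((c' a b).toMul : S) = φ (c a b).toMul}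

lemma map_injective (hφ : Function.Injective φ) : Function.Injective (map (δ := δ) φ hc) := by
  intro b b' h
  refine CrossedLaurent.ext fun a => MvPolynomial.map_injective φ hφ ?_
  rw [← coeff_map φ hc, ← coeff_map φ hc, h]

lemma mem_range_map_of_coeffs_subset {b : CrossedLaurent δ c'} (hb : ∀ x ∈ b.coeffs, x ∈ φ.range) :
    b ∈ (map (δ := δ) φ hc).range := by
  rw [← sum_single b]
  refine sum_mem fun a _ => ?_
  obtain ⟨p, hp⟩ := MvPolynomial.mem_range_map_iff_coeffs_subset.2
    (show ((b.coeff a).coeffs : Set S) ⊆ Set.range φ from fun x hx => by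
      obtain ⟨s, -, rfl⟩ := mem_coeffs_iff.1 hx
      exact hb _ (mem_coeffs.2 ⟨fun h => zero_notMem_coeffs _ (h ▸ hx), a, s, rfl⟩))
  refine ⟨single _ _ a p, CrossedLaurent.ext fun a' => ?_⟩
  classical
  rw [coeff_map, coeff_single, coeff_single]
  split_ifs
  · exact hp
  · exact map_zero _

lemma map_ne_zero_of_coeff {b : CrossedLaurent δ c} {a : Γ} {s : J →₀ ℕ}
    (hb : φ ((b.coeff a).coeff s) ≠ 0) : map φ hc b ≠ 0 := by
  intro h
  refine hb ?_
  rw [← MvPolynomial.coeff_map, ← coeff_map φ hc, h, coeff_zero, MvPolynomial.coeff_zero]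

end Coeffs

end CrossedLaurent

/-- Elements of a division ring of fractions which generate a localized Weyl algebra specialize to
matrices over a field of characteristic `p`. -/
lemma pow_dvd_card_of_fractions {A D L H : Type*} [Ring A] [DivisionRing D] [Field L]
    [IsAlgClosed L] [Fintype H] [DecidableEq H] [Nonempty H] {p : ℕ} (hp : p.Prime) [CharP L p]
    {i : A →+* D}
    (hi : Function.Injective i) (ρ : A →+* Matrix H H L)
    (ore : ∀ c b, IsUnit (ρ b) → ∃ c' b', IsUnit (ρ b') ∧ c * b' = b * c') {r : ℕ}
    {a b a' b' : Fin r → A} (ha : ∀ j, IsUnit (ρ (a j))) (hb : ∀ j, IsUnit (ρ (b j)))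
    (hb' : ∀ j, IsUnit (ρ (b' j))) {X W : Fin r → D} (hX : ∀ j, X j = i (a j) * (i (b j))⁻¹)
    (hW : ∀ j, W j = i (a' j) * (i (b' j))⁻¹) (hWW : ∀ j l, Commute (W j) (W l))
    (hXW : ∀ j l, X j * W l = (W l + if j = l then 1 else 0) * X j) : p ^ r ∣ Fintype.card H := by
  choose φ hφ hφa using fun j => exists_mem_fractionGraph (i := i) (ore := ore) hi (a := a j)
    (hb j)
  choose ψ hψ hψa using fun j => exists_mem_fractionGraph (i := i) (ore := ore) hi (a := a' j)
    (hb' j)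
  have hφ' : ∀ j, (X j, φ j) ∈ fractionGraph i ρ ore := fun j => by rw [hX]; exact hφ j
  have hψ' : ∀ j, (W j, ψ j) ∈ fractionGraph i ρ ore := fun j => by rw [hW]; exact hψ j
  have hφu : ∀ j, IsUnit (φ j) := fun j => by
    obtain ⟨u, hu⟩ := hb j
    rw [← Units.isUnit_mul_units _ u, hu, hφa]
    exact ha j
  have hmul : ∀ {d d' x x'}, (d, x) ∈ fractionGraph i ρ ore → (d', x') ∈ fractionGraph i ρ ore →
      (d * d', x * x') ∈ fractionGraph i ρ ore := fun h h' => by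
    simpa only [Prod.mk_mul_mk] using mul_mem h h'
  have hψψ : ∀ j l, ψ j * ψ l = ψ l * ψ j := fun j l => by
    refine fractionGraph_unique hi (hmul (hψ' j) (hψ' l)) ?_
    rw [(hWW j l).eq]
    exact hmul (hψ' l) (hψ' j)
  have hφψ : ∀ j l, φ j * ψ l = (ψ l + if j = l then 1 else 0) * φ j := fun j l => by
    refine fractionGraph_unique hi (hmul (hφ' j) (hψ' l)) ?_
    rw [hXW]
    refine hmul ?_ (hφ' j)
    by_cases hjl : j = l
    · have := add_mem (hψ' l) (one_mem (fractionGraph i ρ ore))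
      rw [Prod.one_eq_mk, Prod.mk_add_mk] at this
      rwa [if_pos hjl, if_pos hjl]
    · rw [if_neg hjl, if_neg hjl, add_zero, add_zero]
      exact hψ' l
  have hdvd := pow_dvd_finrank_of_weyl hp (fun j => Matrix.toLinAlgEquiv' (φ j))
    (fun j => Matrix.toLinAlgEquiv' (ψ j)) (fun j => (hφu j).map _)
    (fun j l => Commute.map (hψψ j l) _) fun j l => by
      rw [← map_mul, hφψ, map_mul, map_add]
      split_ifs <;> simp
  rwa [Module.finrank_fintype_fun_eq_card] at hdvd

namespace MixedWeylAlgebra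

open MvPolynomial CrossedLaurent

section Residue

variable {m n t : ℕ}

lemma coe_cocycle_units_map {R S : Type*} [CommRing R] [CommRing S] (φ : R →+* S) (q : Fin n → Rˣ)
    (a b : MWGen.Index m n t → ℤ) :
    (((cocycle m t (fun i => Units.map φ (q i)) a b).toMul : Sˣ) : S) =
      φ ((cocycle m t q a b).toMul : Rˣ) := by
  rw [cocycle_apply, cocycle_apply, toMul_sum, toMul_sum]
  change _ = ((Units.map (φ : R →* S) _ : Sˣ) : S)
  rw [map_prod]
  simp only [toMul_zsmul, toMul_ofMul, map_zpow]

/-- Change of coefficients for the localization of `A_{m,n,t}^{q̄}`. -/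
noncomputable abbrev Model.map {R S : Type*} [CommRing R] [CommRing S] (φ : R →+* S)
    (q : Fin n → Rˣ) :
    Model m t q →+* Model m t fun i => Units.map (φ : R →* S) (q i) :=
  CrossedLaurent.map φ (coe_cocycle_units_map φ q)

/-- In positive characteristic and at roots of unity, the localization of `A_{m,n,t}^{q̄}` is
represented by matrices. -/
lemma exists_matrix_representation {K : Type u} [Field K] {p N : ℕ} [NeZero p] [NeZero N]
    [CharP K p] (q : Fin n → Kˣ) (hq : ∀ i, q i ^ N = 1) :
    ∃ (L : Type u) (_ : Field L) (_ : IsAlgClosed L) (_ : CharP L p)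
      (ρ : Model m t q →+* Matrix ((Fin m → ZMod p) × (Fin n → ZMod N))
        ((Fin m → ZMod p) × (Fin n → ZMod N)) L), ∀ b, b ≠ 0 → IsUnit (ρ b) := by
  let C := AddMonoidAlgebra (MvPolynomial (Fin m) K) (MWGen.Index m n t → ℤ)
  let L := AlgebraicClosure (FractionRing C)
  let H := (Fin m → ZMod p) × (Fin n → ZMod N)
  let π : (MWGen.Index m n t → ℤ) →+ H := AddMonoidHom.mk'
    (fun a => (fun i => (a (.inl i) : ZMod p), fun i => (a (.inr (.inl i)) : ZMod N)))
    fun a b => Prod.ext (funext fun _ => Int.cast_add _ _) (funext fun _ => Int.cast_add _ _)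
  let d : Fin m → H →+ K := fun j => AddMonoidHom.mk' (fun h => ZMod.castHom dvd_rfl K (h.1 j))
    fun h h' => map_add (ZMod.castHom dvd_rfl K) (h.1 j) (h'.1 j)
  let z : Fin n → ZMod N →+ Additive Kˣ := fun i => ZMod.lift N
    ⟨zmultiplesHom _ (Additive.ofMul (q i)), by
      simp [← ofMul_pow, hq]⟩
  let χ : H →+ (MWGen.Index m n t → ℤ) →+ Additive Kˣ := AddMonoidHom.mk'
    (fun h => AddMonoidHom.mk' (fun b => ∑ i, b (.inr (.inr (.inl i))) • z i (h.2 i))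
      fun b b' => by simp [add_zsmul, Finset.sum_add_distrib])
    fun h h' => AddMonoidHom.ext fun b => by
      rw [AddMonoidHom.add_apply]
      simp only [AddMonoidHom.mk'_apply, ← Finset.sum_add_distrib, ← zsmul_add, ← map_add]
      rfl
  have hd : ∀ j a, d j (π a) = (weylDegree m n t j a : K) := fun j a => by
    simp [d, π]
  have hχ : ∀ a, χ (π a) = cocycle m t q a := fun a => by
    refine AddMonoidHom.ext fun b => ?_
    rw [cocycle_apply]
    have hz : ∀ i, z i (a (.inr (.inl i)) : ZMod N) = a (.inr (.inl i)) • Additive.ofMul (q i) :=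
      fun i => ZMod.lift_coe _ _ _
    change ∑ i, b (.inr (.inr (.inl i))) • z i (a (.inr (.inl i)) : ZMod N) = _
    exact Finset.sum_congr rfl fun i _ => by rw [hz, mul_comm, mul_zsmul]
  have : CharP L p := charP_of_injective_algebraMap
    (((algebraMap C L).comp (AddMonoidAlgebra.singleZeroRingHom.comp MvPolynomial.C)).injective) p
  refine ⟨L, inferInstance, inferInstance, this,
    ((algebraMap C L).mapMatrix).comp (toMatrix π d hd χ hχ), fun b hb => ?_⟩
  have hCL : Function.Injective (algebraMap C L) := by
    rw [IsScalarTower.algebraMap_eq C (FractionRing C) L]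
    exact (algebraMap (FractionRing C) L).injective.comp (IsFractionRing.injective C _)
  rw [RingHom.comp_apply, Matrix.isUnit_iff_isUnit_det, ← RingHom.map_det, isUnit_iff_ne_zero,
    map_ne_zero_iff _ hCL]
  exact det_toMatrix_ne_zero hb

/-- Two elements of the localization of `A_{m,n,t}^{q̄}` have proportional integral representatives
which do not both vanish in the residue field. -/
lemma exists_integral_multiple {k : Type u} [Field k] (V : ValuationSubring k) (q : Fin n → Vˣ)
    (b c : Model m t fun i => Units.map (V.subtype : V →* k) (q i)) (hb : b ≠ 0) :
    ∃ (s : k) (b' c' : Model m t q), Model.map V.subtype q b' = s • b ∧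
      Model.map V.subtype q c' = s • c ∧
      (Model.map (IsLocalRing.residue V) q b' = 0 →
        Model.map (IsLocalRing.residue V) q c' ≠ 0) := by
  classical
  obtain ⟨x, hx, hmax⟩ := (b.coeffs ∪ c.coeffs).exists_max_image V.valuation
    ((coeffs_nonempty hb).mono Finset.subset_union_left)
  have hx0 : x ≠ 0 := by
    rcases Finset.mem_union.1 hx with h | h <;> exact ne_zero_of_mem_coeffs h
  have hV : ∀ y ∈ b.coeffs ∪ c.coeffs, x⁻¹ * y ∈ V := fun y hy => by
    rw [← V.valuation_le_one_iff, map_mul, map_inv₀,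
      inv_mul_le_one₀ (zero_lt_iff.2 ((map_ne_zero _).2 hx0))]
    exact hmax y hy
  have hlift : ∀ a : Model m t fun i => Units.map (V.subtype : V →* k) (q i),
      a.coeffs ⊆ b.coeffs ∪ c.coeffs → ∃ a', Model.map V.subtype q a' = x⁻¹ • a := by
    intro a ha
    refine mem_range_map_of_coeffs_subset fun y hy => ?_
    obtain ⟨y, hya, rfl⟩ := exists_of_mem_coeffs_smul hy
    exact ⟨⟨_, hV y (ha hya)⟩, rfl⟩
  obtain ⟨b', hb'⟩ := hlift b Finset.subset_union_left
  obtain ⟨c', hc'⟩ := hlift c Finset.subset_union_right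
  have hne : ∀ (a' : Model m t q) (a : Model m t fun i => Units.map (V.subtype : V →* k) (q i)),
      Model.map V.subtype q a' = x⁻¹ • a → x ∈ a.coeffs →
      Model.map (IsLocalRing.residue V) q a' ≠ 0 := by
    intro a' a ha hxa
    obtain ⟨-, γ, s, hs⟩ := mem_coeffs.1 hxa
    have h1 : (a'.coeff γ).coeff s = 1 := V.subtype_injective (by
      rw [← MvPolynomial.coeff_map, ← CrossedLaurent.coeff_map _ (coe_cocycle_units_map _ _), ha,
        CrossedLaurent.coeff_smul,
        MvPolynomial.coeff_smul, hs, smul_eq_mul, inv_mul_cancel₀ hx0, map_one])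
    refine map_ne_zero_of_coeff (a := γ) (s := s) ?_
    rw [h1, map_one]
    exact one_ne_zero
  refine ⟨x⁻¹, b', c', hb', hc', fun h => ?_⟩
  rcases Finset.mem_union.1 hx with hx | hx
  · exact absurd h (hne b' b hb' hx)
  · exact hne c' c hc' hx

/-- Integral representatives of an element whose nonzero scalars are units. -/
lemma exists_integral_lift {k : Type u} [Field k] (V : ValuationSubring k) (q : Fin n → Vˣ)
    (b : Model m t fun i => Units.map (V.subtype : V →* k) (q i))
    (hb : ∀ x ∈ b.coeffs, ∃ v : Vˣ, ((v : V) : k) = x) :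
    ∃ b' : Model m t q, Model.map V.subtype q b' = b ∧
      (b ≠ 0 → Model.map (IsLocalRing.residue V) q b' ≠ 0) := by
  obtain ⟨b', hb'⟩ : ∃ b', Model.map V.subtype q b' = b :=
    mem_range_map_of_coeffs_subset fun x hx => by
      obtain ⟨v, hv⟩ := hb x hx
      exact ⟨v, hv⟩
  refine ⟨b', hb', fun hb0 => ?_⟩
  obtain ⟨x, hx⟩ := coeffs_nonempty hb0
  obtain ⟨v, hv⟩ := hb x hx
  obtain ⟨-, γ, s, hs⟩ := mem_coeffs.1 hx
  have h1 : (b'.coeff γ).coeff s = v := V.subtype_injective (by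
    rw [← MvPolynomial.coeff_map, ← CrossedLaurent.coeff_map _ (coe_cocycle_units_map _ _), hb',
      hs, ← hv]
    rfl)
  refine map_ne_zero_of_coeff (a := γ) (s := s) ?_
  rw [h1]
  exact (v.isUnit.map (IsLocalRing.residue V)).ne_zero

end Residue

variable {m n t : ℕ}

lemma model_rightOre {k : Type u} [Field k] (q : Fin n → kˣ) (a b : Model m t q) (hb : b ≠ 0) :
    ∃ c d : Model m t q, d ≠ 0 ∧ a * d = b * c := by
  obtain ⟨γ, ⟨a', ha⟩, b', hb'⟩ := exists_common_single_mul_mem_range q a b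
  have hb0 : b' ≠ 0 := by
    rintro rfl
    exact mul_ne_zero (single_one_ne_zero q γ) hb (hb'.symm.trans (map_zero _))
  obtain ⟨c, d, hd, h⟩ := (quasiWeylGenerators fun i => (q i).ne_zero).exists_right_ore a' b' hb0
  refine ⟨toModel q c, toModel q d, (map_ne_zero_iff _ (toModel_injective q)).2 hd,
    mul_left_cancel₀ (single_one_ne_zero q γ) ?_⟩
  have h' := congrArg (toModel q) h
  rw [map_mul, map_mul] at h'
  rw [← mul_assoc, ← mul_assoc]
  exact (congrArg (· * _) ha.symm).trans (h'.trans (congrArg (· * _) hb'))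

lemma exists_integral_ore {k : Type u} [Field k] (V : ValuationSubring k) (q : Fin n → Vˣ)
    (c : Model m t q) {b : Model m t q} (hb : Model.map (IsLocalRing.residue V) q b ≠ 0) :
    ∃ c' b', Model.map (IsLocalRing.residue V) q b' ≠ 0 ∧ c * b' = b * c' := by
  have hinj : Function.Injective (Model.map (m := m) (t := t) V.subtype q) :=
    map_injective V.subtype_injective
  have hb0 : Model.map V.subtype q b ≠ 0 := by
    rw [map_ne_zero_iff _ hinj]
    rintro rfl
    exact hb (map_zero _)
  obtain ⟨c₁, b₁, hb₁, h⟩ := model_rightOre _ (Model.map V.subtype q c) _ hb0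
  obtain ⟨s, b', c', hsb, hsc, h0⟩ := exists_integral_multiple V q b₁ c₁ hb₁
  have heq : c * b' = b * c' := hinj (by
    rw [map_mul, map_mul, hsb, hsc, mul_smul_comm, mul_smul_comm, h])
  refine ⟨c', b', fun hb'0 => h0 hb'0 ?_, heq⟩
  have := congrArg (Model.map (IsLocalRing.residue V) q) heq
  rw [map_mul, map_mul, hb'0, mul_zero] at this
  exact (mul_eq_zero.1 this.symm).resolve_left hb

lemma le_of_integral_weyl {k : Type u} [Field k] (V : ValuationSubring k) {p N : ℕ} (hp : p.Prime)
    (hN : 0 < N) (hpN : p.Coprime N) [CharP (IsLocalRing.ResidueField V) p] (q : Fin n → Vˣ)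
    (hq : ∀ i, IsLocalRing.residue V (q i) ^ N = 1) {D : Type*} [DivisionRing D]
    (f : Model m t (fun i => Units.map (V.subtype : V →* k) (q i)) →+* D)
    (hf : Function.Injective f) {r : ℕ} (a b a' b' : Fin r → Model m t q)
    (ha : ∀ i, Model.map (IsLocalRing.residue V) q (a i) ≠ 0)
    (hb : ∀ i, Model.map (IsLocalRing.residue V) q (b i) ≠ 0)
    (hb' : ∀ i, Model.map (IsLocalRing.residue V) q (b' i) ≠ 0)
    (X W : Fin r → D)
    (hX : ∀ i, X i = f (Model.map V.subtype q (a i)) * (f (Model.map V.subtype q (b i)))⁻¹)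
    (hW : ∀ i, W i = f (Model.map V.subtype q (a' i)) * (f (Model.map V.subtype q (b' i)))⁻¹)
    (hWW : ∀ i j, Commute (W i) (W j))
    (hXW : ∀ i j, X i * W j = (W j + if i = j then 1 else 0) * X i) : r ≤ m := by
  have : NeZero p := ⟨hp.ne_zero⟩
  have : NeZero N := ⟨hN.ne'⟩
  obtain ⟨L, _, _, _, ρ₀, hρ₀⟩ := exists_matrix_representation (m := m) (t := t) (p := p) (N := N)
    (fun i => Units.map (IsLocalRing.residue V : V →* IsLocalRing.ResidueField V) (q i))
    fun i => Units.ext (hq i)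
  let ρ := ρ₀.comp (Model.map (IsLocalRing.residue V) q)
  have hρ : ∀ b, IsUnit (ρ b) ↔ Model.map (IsLocalRing.residue V) q b ≠ 0 := fun b => by
    refine ⟨fun h h0 => h.ne_zero ?_, hρ₀ _⟩
    rw [RingHom.comp_apply, h0, map_zero]
  let i := f.comp (Model.map (m := m) (t := t) V.subtype q)
  have hi : Function.Injective i := hf.comp (map_injective V.subtype_injective)
  have ore : ∀ c b, IsUnit (ρ b) → ∃ c' b', IsUnit (ρ b') ∧ c * b' = b * c' := by
    intro c b hb
    obtain ⟨c', b', h, h'⟩ := exists_integral_ore V q c ((hρ b).1 hb)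
    exact ⟨c', b', (hρ b').2 h, h'⟩
  have hdvd := pow_dvd_card_of_fractions hp hi ρ ore (fun j => (hρ _).2 (ha j))
    (fun j => (hρ _).2 (hb j)) (fun j => (hρ _).2 (hb' j)) hX hW hWW hXW
  rw [Fintype.card_prod, Fintype.card_fun, Fintype.card_fun,
    ZMod.card, ZMod.card, Fintype.card_fin, Fintype.card_fin] at hdvd
  exact (Nat.pow_dvd_pow_iff_le_right hp.one_lt).1
    ((Nat.Coprime.pow r n hpN).dvd_of_dvd_mul_right hdvd)

lemma le_of_weyl {k : Type u} [Field k] (q : Fin n → kˣ) {D : Type*} [DivisionRing D]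
    (f : Model m t q →+* D) (hf : Function.Injective f)
    (hfrac : ∀ d, ∃ a b, b ≠ 0 ∧ d = f a * (f b)⁻¹) {r : ℕ} (X W : Fin r → D)
    (hX : ∀ i, X i ≠ 0) (hW : ∀ i j, Commute (W i) (W j))
    (hXW : ∀ i j, X i * W j = (W j + if i = j then 1 else 0) * X i) : r ≤ m := by
  classical
  choose a b hb hab using fun i => hfrac (X i)
  choose a' b' hb' hab' using fun i => hfrac (W i)
  have ha : ∀ i, a i ≠ 0 := fun i h => hX i (by rw [hab, h, map_zero, zero_mul])
  let T : Finset k := Finset.univ.biUnion fun i =>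
    (a i).coeffs ∪ (b i).coeffs ∪ (a' i).coeffs ∪ (b' i).coeffs
  obtain ⟨V, p, N, hp, hV, hN, hpN, hU⟩ := exists_valuationSubring_residue_pow_eq_one
    (Finset.univ.image q ∪ T.preimage Units.val Units.val_injective.injOn)
  choose v hv hvN using fun i => hU (q i)
    (Finset.mem_union_left _ (Finset.mem_image_of_mem _ (Finset.mem_univ _)))
  obtain rfl : q = fun i => Units.map (V.subtype : V →* k) (v i) :=
    funext fun i => Units.ext (hv i).symm
  have hT : ∀ x ∈ T, x ≠ 0 → ∃ v : Vˣ, ((v : V) : k) = x := fun x hx hx0 => by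
    obtain ⟨v, hv, -⟩ := hU (Units.mk0 x hx0) (Finset.mem_union_right _ (by simpa using hx))
    exact ⟨v, hv⟩
  have hlift : ∀ b : Model m t fun i => Units.map (V.subtype : V →* k) (v i), b.coeffs ⊆ T → _ :=
    fun b hb => exists_integral_lift V v b fun x hx => hT x (hb hx) (ne_zero_of_mem_coeffs hx)
  have hTi : ∀ i, (a i).coeffs ∪ (b i).coeffs ∪ (a' i).coeffs ∪ (b' i).coeffs ⊆ T := fun i =>
    Finset.subset_biUnion_of_mem (fun i => (a i).coeffs ∪ (b i).coeffs ∪ (a' i).coeffs ∪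
      (b' i).coeffs) (Finset.mem_univ i)
  simp only [Finset.union_subset_iff] at hTi
  choose A hA hA0 using fun i => hlift (a i) (hTi i).1.1.1
  choose B hB hB0 using fun i => hlift (b i) (hTi i).1.1.2
  choose A' hA' hA0' using fun i => hlift (a' i) (hTi i).1.2
  choose B' hB' hB0' using fun i => hlift (b' i) (hTi i).2
  refine le_of_integral_weyl V hp hN hpN v hvN f hf A B A' B' (fun i => hA0 i (ha i))
    (fun i => hB0 i (hb i)) (fun i => hB0' i (hb' i)) X W (fun i => ?_) (fun i => ?_) hW hXW
  · rw [hA, hB]; exact hab i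
  · rw [hA', hB']; exact hab' i

end MixedWeylAlgebra

namespace MixedCrossedAlgebra

open MixedWeylAlgebra

variable {k : Type u} [Field k] {n : ℕ} {Λ : Matrix (Fin n) (Fin n) k} {r : ℕ} {hr : r ≤ n}

variable (Λ hr) in
/-- The product `x_i y_i`. -/
noncomputable def xy (i : Fin r) : MixedCrossedAlgebra k Λ r hr :=
  x k Λ r hr i * y k Λ r hr (Fin.castLE hr i)

lemma y_mul_xy (hΛ : Λ.MulAntisymmetric) {i : Fin n} {j : Fin r} (hij : Fin.castLE hr j ≠ i) :
    y k Λ r hr i * xy Λ hr j = xy Λ hr j * y k Λ r hr i := by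
  have hne : Λ (Fin.castLE hr j) i ≠ 0 := left_ne_zero_of_mul_eq_one (hΛ.2 _ i)
  have h := x_mul_y_ne (k := k) (Λ := Λ) (hr := hr) j i hij
  rw [eq_inv_smul_iff₀ hne] at h
  rw [xy, ← mul_assoc, ← h, smul_mul_assoc, mul_assoc, mul_assoc, y_mul_y i, mul_smul_comm,
    smul_smul, hΛ.2, one_smul]

lemma x_mul_xy (hΛ : Λ.MulAntisymmetric) (i j : Fin r) :
    x k Λ r hr i * xy Λ hr j = (xy Λ hr j + if i = j then 1 else 0) * x k Λ r hr i := by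
  by_cases hij : i = j
  · subst hij
    rw [if_pos rfl, xy]
    conv_lhs => rw [x_mul_y_same]
    rw [mul_add, mul_one, add_mul, one_mul, mul_assoc]
  · have hij' : Fin.castLE hr i ≠ Fin.castLE hr j := fun h => hij (Fin.castLE_injective hr h)
    rw [if_neg hij, add_zero, xy, ← mul_assoc, x_mul_x i j, smul_mul_assoc, mul_assoc,
      x_mul_y_ne i _ hij', mul_smul_comm, smul_smul,
      mul_inv_cancel₀ (left_ne_zero_of_mul_eq_one (hΛ.2 _ _)), one_smul, mul_assoc]

lemma commute_xy (hΛ : Λ.MulAntisymmetric) (i j : Fin r) : Commute (xy Λ hr i) (xy Λ hr j) := by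
  by_cases hij : i = j
  · rw [hij]
  · have h := x_mul_xy (hr := hr) hΛ i j
    rw [if_neg hij, add_zero] at h
    exact Commute.mul_left h
      (y_mul_xy hΛ fun h => hij (Fin.castLE_injective hr h).symm)

lemma le_of_embedding (hΛ : Λ.MulAntisymmetric)
    (F : FractionDivisionRing k (MixedCrossedAlgebra k Λ r hr)) {m s t : ℕ} {q : Fin s → k}
    (hq : ∀ i, q i ≠ 0) (D' : FractionDivisionRing k (MixedWeylAlgebra k m s t q))
    (g : F.carrier →ₐ[k] D'.carrier) : r ≤ m := by
  lift q to Fin s → kˣ using fun i => (hq i).isUnit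
  obtain ⟨D, f, hf, hfD⟩ := exists_fractionDivisionRing (m := m) (t := t) q
  obtain ⟨φ⟩ := D'.exists_extension D.emb D.emb_injective
  let ψ : MixedCrossedAlgebra k Λ r hr →ₐ[k] D.carrier := (φ.comp g).comp F.emb
  have hψ : Function.Injective ψ := (φ.comp g).toRingHom.injective.comp F.emb_injective
  have : Nontrivial (MixedCrossedAlgebra k Λ r hr) := F.emb.toRingHom.domain_nontrivial
  refine le_of_weyl q (f : Model m t q →+* D.carrier) hf (fun d => ?_)
    (fun i => ψ (x k Λ r hr i)) (fun i => ψ (xy Λ hr i)) (fun i => ?_)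
    (fun i j => (commute_xy hΛ i j).map ψ) fun i j => ?_
  · obtain ⟨a, b, hb, rfl⟩ := D.frac d
    exact ⟨toModel q a, toModel q b, (map_ne_zero_iff _ (toModel_injective q)).2 hb, by
      simp [hfD]⟩
  · rw [map_ne_zero_iff ψ hψ]
    intro h
    have := x_mul_y_same (k := k) (Λ := Λ) (hr := hr) i
    rw [h, zero_mul, mul_zero, zero_add] at this
    exact zero_ne_one this
  · rw [← map_mul, x_mul_xy hΛ, map_mul, map_add]
    split_ifs <;> simp

end MixedCrossedAlgebra

/-- The w-upper degree of `Frac(S_{n,r}^Λ(k))` is `2r`: `r` is the least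
natural number `m` such that some division ring of fractions of `S_{n,r}^Λ(k)` embeds
into a division ring of fractions of an algebra `A_{m,s,t}^{q̄}(k)`. -/
theorem stmt16 {k : Type u} [Field k] [CharZero k] {n : ℕ} (hn : 1 ≤ n) {r : ℕ} (hr : r ≤ n)
    (Λ : Matrix (Fin n) (Fin n) k) (hΛ : Λ.MulAntisymmetric)
    (F : FractionDivisionRing k (MixedCrossedAlgebra k Λ r hr)) :
    IsLeast {m : ℕ | ∃ (s t : ℕ) (q : Fin s → k), (∀ i, q i ≠ 0 ∧ q i ≠ 1) ∧
      ∃ (D' : FractionDivisionRing k (MixedWeylAlgebra k m s t q))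
        (g : F.carrier →ₐ[k] D'.carrier), Function.Injective g} r := by
  exact ⟨MixedCrossedAlgebra.exists_embedding hr hΛ F, fun m ⟨_, _, _, hq, D', g, _⟩ =>
    MixedCrossedAlgebra.le_of_embedding hΛ F (fun i => (hq i).1) D' g⟩
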